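/- arXiv:math-ph/0404008 — 3 statements merged into one kernel-verified Lean document; each statement's English description precedes it below -/
import Mathlib

section
/- Let W : ℂ → ℂ be meromorphic on all of ℂ, 2πi-periodic (W(z + 2πi) = W(z) for all z ∈ ℂ), and of finite Dirichlet energy on the cylinder, i.e. ∫_{(x,y) ∈ ℝ × (−π,π)} |W′(x+iy)|² / (1 + |W(x+iy)|²)² dx dy < ∞ (the integrand being defined almost everywhere, since the poles of W form a discrete set). Then there exists a unique rational function R ∈ ℂ(w) such that W(z) = R(e^z) for every z outside the discrete set where W has a pole or e^z is a pole of R. -/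
open MeasureTheory Complex

open Filter Topology

lemma aux_entire_poly (F : ℂ → ℂ) (hF : Differentiable ℂ F) (n : ℕ) (C ρ : ℝ)
    (hb : ∀ z, ρ ≤ ‖z‖ → ‖F z‖ ≤ C * ‖z‖ ^ n) :
    ∃ Q : Polynomial ℂ, ∀ z, F z = Q.eval z := by
  have h0 : ∀ m, n < m → iteratedDeriv m F 0 = 0 := by
    intro m hm
    have hle : ∀ᶠ R : ℝ in atTop, ‖iteratedDeriv m F 0‖ ≤ m.factorial * |C| * R⁻¹ := by
      filter_upwards [eventually_ge_atTop ρ, eventually_ge_atTop 1] with R h1 h2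
      have h3 := Complex.norm_iteratedDeriv_le_of_forall_mem_sphere_norm_le (c := 0) (R := R)
        (C := |C| * R ^ n) m (by linarith) hF.diffContOnCl (fun z hz => by
          have hz' : ‖z‖ = R := by simpa using hz
          refine (hb z (by linarith)).trans ?_
          rw [hz']; gcongr; exact le_abs_self C)
      refine h3.trans ?_
      rw [mul_assoc, mul_div_assoc]
      have : |C| * R ^ n / R ^ m ≤ |C| * R⁻¹ := by
        rw [mul_div_assoc]
        gcongr
        rw [div_le_iff₀ (by positivity), inv_mul_eq_div, le_div_iff₀ (by positivity), ← pow_succ]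
        exact pow_le_pow_right₀ h2 hm
      gcongr
    have ht : Tendsto (fun R : ℝ => m.factorial * |C| * R⁻¹) atTop (𝓝 0) := by
      simpa using tendsto_inv_atTop_zero.const_mul (m.factorial * |C|)
    have := ge_of_tendsto ht hle
    simpa using this
  refine ⟨∑ m ∈ Finset.range (n+1), Polynomial.C ((m.factorial : ℂ)⁻¹ * iteratedDeriv m F 0) * Polynomial.X ^ m, fun z => ?_⟩
  rw [← Complex.taylorSeries_eq_of_entire' 0 z hF, tsum_eq_sum (s := Finset.range (n+1))]
  · simp [Polynomial.eval_finsetSum]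
  · intro m hm
    rw [h0 m (by simpa using hm)]; simp

lemma aux_rational (f : ℂ → ℂ) (hf : ∀ z, MeromorphicAt f z)
    (hi : MeromorphicAt (fun w => f w⁻¹) 0) :
    ∃ P Q : Polynomial ℂ, P ≠ 0 ∧ ∀ w, f w * P.eval w = Q.eval w := by
  classical
  set T : Set ℂ := {z | AnalyticAt ℂ f z}ᶜ with hT
  have hTb : ∃ ρ : ℝ, T ⊆ Metric.closedBall 0 ρ := by
    have h1 := hi.eventually_analyticAt
    rw [eventually_nhdsWithin_iff, Metric.eventually_nhds_iff] at h1
    obtain ⟨ε, hε, h1⟩ := h1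
    refine ⟨ε⁻¹, fun z hz => ?_⟩
    by_contra hcon
    apply hz
    have hz1 : ε⁻¹ < ‖z‖ := by simpa using hcon
    have hz0 : z ≠ 0 := by
      rintro rfl
      have : 0 < ε⁻¹ := by positivity
      simp at hz1; linarith
    have h2 := h1 (y := z⁻¹) (by simpa using inv_lt_of_inv_lt₀ hε hz1) (by simpa using hz0)
    have h3 := h2.fun_comp_of_eq (g := fun w : ℂ => f w⁻¹) (f := fun z : ℂ => z⁻¹) (analyticAt_inv hz0) rfl
    simpa using h3
  have hTf : T.Finite := by
    obtain ⟨ρ, hρ⟩ := hTb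
    by_contra hinf
    obtain ⟨z, -, hz⟩ := Set.Infinite.exists_accPt_of_subset_isCompact hinf (isCompact_closedBall (0:ℂ) ρ) hρ
    rw [accPt_iff_frequently_nhdsNE] at hz
    exact hz (by
      filter_upwards [(hf z).eventually_analyticAt] with w hw
      simpa [hT] using hw)
  choose n hn using hf
  set P : Polynomial ℂ := ∏ t ∈ hTf.toFinset, (Polynomial.X - Polynomial.C t) ^ (n t) with hP
  have hP0 : P ≠ 0 := Finset.prod_ne_zero_iff.2 fun t _ => pow_ne_zero _ (Polynomial.X_sub_C_ne_zero t)
  have hA : ∀ z, AnalyticAt ℂ (fun z => f z * P.eval z) z := by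
    intro z
    have hpol : ∀ p : Polynomial ℂ, AnalyticAt ℂ (fun z => p.eval z) z := fun p =>
      AnalyticOnNhd.eval_polynomial p z trivial
    by_cases hz : AnalyticAt ℂ f z
    · exact hz.mul (hpol P)
    · have hmem : z ∈ hTf.toFinset := by simpa [hT] using hz
      have := (hn z).mul (hpol (∏ t ∈ hTf.toFinset.erase z, (Polynomial.X - Polynomial.C t) ^ (n t)))
      refine this.congr (Eventually.of_forall fun w => ?_)
      simp only [smul_eq_mul, hP, ← Finset.mul_prod_erase _ _ hmem, Polynomial.eval_mul, Polynomial.eval_pow, Polynomial.eval_sub, Polynomial.eval_X, Polynomial.eval_C, Pi.mul_apply]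
      ring
  have hPi : MeromorphicAt (fun w : ℂ => P.eval w⁻¹) 0 := by
    have : (fun w : ℂ => P.eval w⁻¹) = fun w => ∑ i ∈ Finset.range (P.natDegree + 1), P.coeff i * (w⁻¹)^i := by
      ext w; rw [Polynomial.eval_eq_sum_range]
    rw [this]
    fun_prop
  have hm : MeromorphicAt (fun w : ℂ => f w⁻¹ * P.eval w⁻¹) 0 := hi.mul hPi
  obtain ⟨N, hN⟩ := hm
  have hbd : ∀ᶠ w in 𝓝 (0:ℂ), ‖w ^ N * (f w⁻¹ * P.eval w⁻¹)‖ < ‖(0:ℂ) ^ N * (f (0:ℂ)⁻¹ * P.eval (0:ℂ)⁻¹)‖ + 1 := by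
    have := hN.continuousAt.norm
    have := this.eventually_lt_const (lt_add_one _)
    simpa using this
  obtain ⟨ε, hε, hbd⟩ := Metric.eventually_nhds_iff.1 hbd
  obtain ⟨Q, hQ⟩ := aux_entire_poly (fun z => f z * P.eval z) (fun z => (hA z).differentiableAt) N (‖(0:ℂ) ^ N * (f (0:ℂ)⁻¹ * P.eval (0:ℂ)⁻¹)‖ + 1) (2 * ε⁻¹) (by
    intro z hz
    have hεp : 0 < ε⁻¹ := by positivity
    have hzp : 0 < ‖z‖ := by linarith
    have h2 := hbd (y := z⁻¹) (by simpa using inv_lt_of_inv_lt₀ hε (by linarith))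
    rw [inv_inv, norm_mul, norm_pow, norm_inv, inv_pow, inv_mul_eq_div, div_lt_iff₀ (by positivity)] at h2
    exact h2.le)
  exact ⟨P, Q, hP0, hQ⟩

lemma aux_per_exp {P : ℂ → ℂ} (hper : ∀ z, P (z + 2 * Real.pi * I) = P z) {a b : ℂ}
    (h : exp a = exp b) : P a = P b := by
  obtain ⟨n, hn⟩ := Complex.exp_eq_exp_iff_exists_int.1 h
  have hp : Function.Periodic P (2 * Real.pi * I) := hper
  rw [hn]
  exact (hp.int_mul n) b

lemma aux_log_branch {P : ℂ → ℂ} (hper : ∀ z, P (z + 2 * Real.pi * I) = P z) {w₀ : ℂ}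
    (hw : w₀ ≠ 0) : ∃ l : ℂ → ℂ, AnalyticAt ℂ l w₀ ∧ l w₀ = log w₀ ∧
      (fun w => P (log w)) =ᶠ[𝓝 w₀] fun w => P (l w) := by
  refine ⟨fun w => log (w / w₀) + log w₀, ?_, ?_, ?_⟩
  · have h1 : AnalyticAt ℂ (fun w => w / w₀) w₀ := by fun_prop
    exact (h1.clog (by simp [hw])).add analyticAt_const
  · simp [hw]
  · filter_upwards [isOpen_ne.mem_nhds hw] with w hw'
    apply aux_per_exp hper
    have : w / w₀ ≠ 0 := div_ne_zero hw' hw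
    rw [exp_add, exp_log this, exp_log hw, exp_log hw', div_mul_cancel₀ _ hw]

lemma aux_desc_an {P : ℂ → ℂ} (hper : ∀ z, P (z + 2 * Real.pi * I) = P z) {w₀ : ℂ}
    (hw : w₀ ≠ 0) (h : AnalyticAt ℂ P (log w₀)) : AnalyticAt ℂ (fun w => P (log w)) w₀ := by
  obtain ⟨l, h1, h2, h3⟩ := aux_log_branch hper hw
  refine AnalyticAt.congr ?_ h3.symm
  exact h.fun_comp_of_eq h1 h2

lemma aux_desc_mero {P : ℂ → ℂ} (hper : ∀ z, P (z + 2 * Real.pi * I) = P z) {w₀ : ℂ}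
    (hw : w₀ ≠ 0) (h : MeromorphicAt P (log w₀)) : MeromorphicAt (fun w => P (log w)) w₀ := by
  obtain ⟨l, h1, h2, h3⟩ := aux_log_branch hper hw
  rw [← h2] at h
  exact (h.comp_analyticAt h1).congr (h3.symm.filter_mono nhdsWithin_le_nhds)

lemma aux_an_per {P : ℂ → ℂ} (hper : ∀ z, P (z + 2 * Real.pi * I) = P z) : ∀ z, AnalyticAt ℂ P (z + 2 * Real.pi * I) ↔ AnalyticAt ℂ P z := by
    intro z
    have e : (fun z => P (z + 2 * Real.pi * I)) = P := funext hper
    constructor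
    · intro h
      have := h.fun_comp_of_eq (f := fun z => z + 2 * Real.pi * I) (x := z) (by fun_prop) rfl
      rwa [e] at this
    · intro h
      have := h.fun_comp_of_eq (f := fun z => z - 2 * Real.pi * I) (x := z + 2 * Real.pi * I) (by fun_prop) (by ring)
      refine this.congr (Eventually.of_forall fun w => ?_)
      simpa using (hper (w - 2 * Real.pi * I)).symm

lemma aux_an_exp {P : ℂ → ℂ} (hper : ∀ z, P (z + 2 * Real.pi * I) = P z) {a b : ℂ}
    (h : exp a = exp b) : AnalyticAt ℂ P a ↔ AnalyticAt ℂ P b := by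
  classical
  have := aux_per_exp (P := fun z => if AnalyticAt ℂ P z then 1 else 0)
    (by intro z; simp only [aux_an_per hper]) h
  by_cases h1 : AnalyticAt ℂ P a <;> by_cases h2 : AnalyticAt ℂ P b <;> simp_all

/-- meromorphic continuation to the end -/
lemma aux_end_mero {P : ℂ → ℂ} (hper : ∀ z, P (z + 2 * Real.pi * I) = P z)
    (hP : ∀ z, AnalyticAt ℂ P z ∨ ((∀ᶠ w in 𝓝[≠] z, AnalyticAt ℂ P w) ∧
      Tendsto P (𝓝[≠] z) (Bornology.cobounded ℂ)))
    (c : ℂ) (r x₀ : ℝ) (hr : 0 < r)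
    (hmiss : ∀ z, AnalyticAt ℂ P z → z.re < x₀ → r ≤ ‖P z - c‖) :
    MeromorphicAt (fun w => P (log w)) 0 := by
  classical
  set H : ℂ → ℂ := fun z => if AnalyticAt ℂ P z then (P z - c)⁻¹ else 0 with hH
  have hanper := aux_an_per hper
  have hHper : ∀ z, H (z + 2 * Real.pi * I) = H z := by
    intro z
    simp only [hH, hanper, hper]
  have hHb : ∀ z, z.re < x₀ → ‖H z‖ ≤ r⁻¹ := by
    intro z hz
    simp only [hH]
    split_ifs with h
    · rw [norm_inv]; exact inv_anti₀ hr (hmiss z h hz)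
    · simp; positivity
  have hHan1 : ∀ z, z.re < x₀ → AnalyticAt ℂ P z → AnalyticAt ℂ H z := by
    intro z hz h
    have hne : P z - c ≠ 0 := by
      have := hmiss z h hz
      intro h0; rw [h0, norm_zero] at this; linarith
    refine ((h.sub analyticAt_const).inv hne).congr ?_
    filter_upwards [h.eventually_analyticAt] with w hw
    simp [hH, hw]
  have hre : ∀ z : ℂ, z.re < x₀ → ∀ᶠ w in 𝓝 z, w.re < x₀ := fun z hz =>
    continuous_re.continuousAt.eventually_lt_const hz
  have hHan : ∀ z, z.re < x₀ → AnalyticAt ℂ H z := by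
    intro z hz
    by_cases h : AnalyticAt ℂ P z
    · exact hHan1 z hz h
    obtain ⟨h1, h2⟩ := (hP z).resolve_left h
    apply analyticAt_of_differentiable_on_punctured_nhds_of_continuousAt
    · filter_upwards [h1, (hre z hz).filter_mono nhdsWithin_le_nhds] with w hw hw'
      exact (hHan1 w hw' hw).differentiableAt
    · rw [continuousAt_iff_punctured_nhds]
      have e : H z = 0 := by simp [hH, h]
      rw [e]
      have h3 : Tendsto (fun w => P w - c) (𝓝[≠] z) (Bornology.cobounded ℂ) := by
        exact (tendsto_sub_const_cobounded c).comp h2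
      refine (tendsto_inv₀_cobounded.comp h3).congr' ?_
      filter_upwards [h1] with w hw
      simp [hH, hw]
  -- descend
  set h : ℂ → ℂ := fun w => H (log w) with hh
  have hlog : ∀ w : ℂ, w ≠ 0 → ‖w‖ < Real.exp x₀ → (log w).re < x₀ := by
    intro w hw h1
    rw [log_re]
    exact (Real.log_lt_iff_lt_exp (by positivity)).2 h1
  set s : Set ℂ := Metric.ball 0 (Real.exp x₀)
  have hs : s ∈ 𝓝 (0:ℂ) := Metric.ball_mem_nhds _ (Real.exp_pos _)
  have hd : DifferentiableOn ℂ h (s \ {0}) := by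
    rintro w ⟨hw, hw0⟩
    have hw0 : w ≠ 0 := hw0
    have hw1 : ‖w‖ < Real.exp x₀ := by simpa [s] using hw
    exact (aux_desc_an hHper hw0 (hHan _ (hlog w hw0 hw1))).differentiableAt.differentiableWithinAt
  have hb : BddAbove (norm ∘ h '' (s \ {0})) := by
    refine ⟨r⁻¹, ?_⟩
    rintro _ ⟨w, ⟨hw, hw0⟩, rfl⟩
    have hw1 : ‖w‖ < Real.exp x₀ := by simpa [s] using hw
    exact hHb _ (hlog w hw0 hw1)
  have hext := differentiableOn_update_limUnder_of_bddAbove hs hd hb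
  set k := Function.update h 0 (limUnder (𝓝[≠] 0) h) with hk
  have hkan : AnalyticAt ℂ k 0 := hext.analyticAt hs
  have hkne : ∀ w, w ≠ 0 → k w = h w := fun w hw => by simp [hk, hw]
  rcases hkan.eventually_eq_zero_or_eventually_ne_zero with h0 | h0
  · exfalso
    obtain ⟨ε, hε, h0⟩ := Metric.eventually_nhds_iff.1 h0
    obtain ⟨x, hx1, hx2⟩ : ∃ x : ℝ, x < x₀ ∧ Real.exp x < ε :=
      ((eventually_lt_atBot x₀).and (Real.tendsto_exp_atBot.eventually_lt_const hε)).exists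
    have hU : ∀ᶠ z in 𝓝 (x:ℂ), H z = 0 := by
      have : ∀ᶠ z in 𝓝 (x:ℂ), ‖exp z‖ < ε := by
        refine (continuous_exp.norm.continuousAt).eventually_lt_const ?_
        simpa [Complex.norm_exp] using hx2
      filter_upwards [this] with z hz
      have h1 := h0 (y := exp z) (by simpa using hz)
      rw [hkne _ (exp_ne_zero z)] at h1
      rw [← h1]
      exact aux_per_exp hHper (by rw [exp_log (exp_ne_zero z)])
    have hU2 : ∀ᶠ z in 𝓝[≠] (x:ℂ), AnalyticAt ℂ P z := by
      rcases hP x with h | h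
      · exact h.eventually_analyticAt.filter_mono nhdsWithin_le_nhds
      · exact h.1
    obtain ⟨z, h1, h2, h3⟩ := ((hU.filter_mono nhdsWithin_le_nhds).and (hU2.and ((hre x (by simpa using hx1)).filter_mono nhdsWithin_le_nhds))).exists
    have := hmiss z h2 h3
    simp only [hH, h2, if_true, inv_eq_zero] at h1
    rw [h1, norm_zero] at this; linarith
  · have hm : MeromorphicAt (fun w => c + (k w)⁻¹) 0 :=
      (MeromorphicAt.const c 0).add hkan.meromorphicAt.inv
    refine hm.congr ?_
    filter_upwards [h0, self_mem_nhdsWithin] with w hw hw0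
    rw [hkne w hw0] at hw ⊢
    simp only [hh, hH] at hw ⊢
    split_ifs with hc
    · simp
    · simp [hc] at hw

lemma aux_curve (G : ℂ → ℂ) (x : ℝ) (han : ∀ y : ℝ, AnalyticAt ℂ G (x + y * I))
    (he : ∫ y in (-Real.pi)..Real.pi, ‖deriv G (x + y * I)‖ ^ 2 / (1 + ‖G (x + y * I)‖ ^ 2) ^ 2 ≤ 1 / 1000)
    (y₁ y₂ : ℝ) (h1 : y₁ ∈ Set.Icc (-Real.pi) Real.pi) (h2 : y₂ ∈ Set.Icc (-Real.pi) Real.pi)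
    (h12 : y₁ ≤ y₂) :
    |(1 + ‖G (x + y₂ * I)‖ ^ 2)⁻¹ - (1 + ‖G (x + y₁ * I)‖ ^ 2)⁻¹| ≤ 1 / 10 := by
  set g : ℝ → ℂ := fun y => G (x + y * I) with hg
  set d : ℝ → ℂ := fun y => deriv G (x + y * I) with hd
  have hline : Continuous fun y : ℝ => (x + y * I : ℂ) := by fun_prop
  have hgc : Continuous g := continuous_iff_continuousAt.2 fun y =>
    ContinuousAt.comp (g := G) (han y).continuousAt hline.continuousAt
  have hdc : Continuous d := continuous_iff_continuousAt.2 fun y =>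
    ContinuousAt.comp (g := deriv G) (han y).deriv.continuousAt hline.continuousAt
  have hgd : ∀ y, HasDerivAt g (d y * I) y := by
    intro y
    have a1 : HasDerivAt (fun y : ℝ => (x + y * I : ℂ)) I y := by
      have := ((hasDerivAt_id y).ofReal_comp.mul_const I).const_add (x : ℂ)
      simpa using this
    exact (han y).differentiableAt.hasDerivAt.comp_of_eq y a1 rfl
  set p : ℝ → ℝ := fun y => -(2 * inner ℝ (g y) (d y * I)) / (1 + ‖g y‖ ^ 2) ^ 2 with hp
  have hpos : ∀ y, 0 < 1 + ‖g y‖ ^ 2 := fun y => by positivity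
  have hpd : ∀ y, HasDerivAt (fun y => (1 + ‖g y‖ ^ 2)⁻¹) (p y) y := by
    intro y
    exact ((hgd y).norm_sq.const_add 1).fun_inv (hpos y).ne'
  have hpc : Continuous p := by
    refine Continuous.div ?_ (by fun_prop) (fun y => (pow_pos (hpos y) 2).ne')
    exact (continuous_const.mul (hgc.inner (hdc.mul continuous_const))).neg
  set e : ℝ → ℝ := fun y => ‖d y‖ ^ 2 / (1 + ‖g y‖ ^ 2) ^ 2 with hee
  have hec : Continuous e := by
    refine Continuous.div (by fun_prop) (by fun_prop) (fun y => (pow_pos (hpos y) 2).ne')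
  have hpe : ∀ y, |p y| ≤ 1 / 200 + 50 * e y := by
    intro y
    have b1 : |inner ℝ (g y) (d y * I)| ≤ ‖g y‖ * ‖d y‖ := by
      simpa using abs_real_inner_le_norm (g y) (d y * I)
    have b2 : |p y| = 2 * |inner ℝ (g y) (d y * I)| / (1 + ‖g y‖ ^ 2) ^ 2 := by
      rw [hp]; simp only [abs_div, abs_neg, abs_mul, abs_two, abs_pow, abs_of_pos (hpos y)]
    rw [b2]
    have b3 : 2 * |inner ℝ (g y) (d y * I)| / (1 + ‖g y‖ ^ 2) ^ 2 ≤ ‖d y‖ / (1 + ‖g y‖ ^ 2) := by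
      rw [div_le_div_iff₀ (pow_pos (hpos y) 2) (hpos y)]
      have : 2 * |inner ℝ (g y) (d y * I)| ≤ ‖d y‖ * (1 + ‖g y‖ ^ 2) := by
        nlinarith [sq_nonneg (‖g y‖ - 1), norm_nonneg (d y)]
      nlinarith [hpos y]
    have b4 : e y = (‖d y‖ / (1 + ‖g y‖ ^ 2)) ^ 2 := by rw [hee, div_pow]
    rw [b4]
    nlinarith [sq_nonneg (‖d y‖ / (1 + ‖g y‖ ^ 2) - 1 / 100)]
  have hftc := intervalIntegral.integral_eq_sub_of_hasDerivAt (a := y₁) (b := y₂) (fun y _ => hpd y)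
    (hpc.intervalIntegrable _ _)
  rw [← hftc]
  have i1 : |∫ y in y₁..y₂, p y| ≤ ∫ y in y₁..y₂, |p y| := intervalIntegral.abs_integral_le_integral_abs h12
  have i2 : ∫ y in y₁..y₂, |p y| ≤ ∫ y in y₁..y₂, (1 / 200 + 50 * e y) :=
    intervalIntegral.integral_mono_on h12 (hpc.abs.intervalIntegrable _ _)
      ((continuous_const.add (continuous_const.mul hec)).intervalIntegrable _ _) (fun y _ => hpe y)
  have i3 : ∫ y in y₁..y₂, (1 / 200 + 50 * e y) ≤ ∫ y in (-Real.pi)..Real.pi, (1 / 200 + 50 * e y) := by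
    refine intervalIntegral.integral_mono_interval h1.1 h12 h2.2 ?_
      ((continuous_const.add (continuous_const.mul hec)).intervalIntegrable _ _)
    refine Eventually.of_forall fun y => ?_
    have : 0 ≤ e y := by rw [hee]; positivity
    simp only [Pi.zero_apply]; linarith
  have i4 : ∫ y in (-Real.pi)..Real.pi, (1 / 200 + 50 * e y) = 2 * Real.pi / 200 + 50 * ∫ y in (-Real.pi)..Real.pi, e y := by
    rw [intervalIntegral.integral_add (continuous_const.intervalIntegrable _ _) ((hec.intervalIntegrable _ _).const_mul 50),
      intervalIntegral.integral_const, intervalIntegral.integral_const_mul]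
    simp only [smul_eq_mul]; ring
  have := Real.pi_lt_d2
  linarith

lemma aux_det (a : ℂ) : |((ContinuousLinearMap.toSpanSingleton ℂ a).restrictScalars ℝ).det| = ‖a‖ ^ 2 := by
  simp [ContinuousLinearMap.det, LinearMap.det_restrictScalars,
      Algebra.norm_complex_eq, Complex.normSq_eq_norm_sq]

lemma aux_area (G : ℂ → ℂ) (c : ℂ) (hc : ‖c‖ ≤ 2) (D : Set ℂ) (hD : MeasurableSet D)
    (han : ∀ z ∈ D, AnalyticAt ℂ G z) (hDb : ∀ z ∈ D, G z ∈ Metric.ball c (1/4))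
    (hsub : Metric.ball c (1/4) ⊆ G '' D)
    (he : ∫⁻ z in D, ENNReal.ofReal (‖deriv G z‖ ^ 2 / (1 + ‖G z‖ ^ 2) ^ 2) ≤ ENNReal.ofReal (1/1000)) :
    False := by
  have h1 := addHaar_image_le_lintegral_abs_det_fderiv volume hD (f := G)
    (f' := fun z => (ContinuousLinearMap.toSpanSingleton ℂ (deriv G z)).restrictScalars ℝ)
    (fun z hz => ((han z hz).differentiableAt.hasDerivAt.hasFDerivAt.restrictScalars ℝ).hasFDerivWithinAt)
  have h2 : ∫⁻ z in D, ENNReal.ofReal |((ContinuousLinearMap.toSpanSingleton ℂ (deriv G z)).restrictScalars ℝ).det|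
      ≤ ∫⁻ z in D, 37 * ENNReal.ofReal (‖deriv G z‖ ^ 2 / (1 + ‖G z‖ ^ 2) ^ 2) := by
    refine setLIntegral_mono' hD fun z hz => ?_
    rw [aux_det, show (37 : ENNReal) = ENNReal.ofReal 37 by simp, ← ENNReal.ofReal_mul (by norm_num)]
    apply ENNReal.ofReal_le_ofReal
    have b1 : ‖G z‖ ≤ 9/4 := by
      have := hDb z hz
      rw [Metric.mem_ball, dist_eq_norm] at this
      have := norm_sub_norm_le (G z) c
      linarith
    have b2 : (1 + ‖G z‖ ^ 2) ^ 2 ≤ 37 := by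
      have : 1 + ‖G z‖ ^ 2 ≤ 1 + (9/4) ^ 2 := by gcongr
      have : (1 + ‖G z‖ ^ 2) ^ 2 ≤ (1 + (9/4) ^ 2) ^ 2 := by gcongr
      norm_num at this ⊢; linarith
    rw [← mul_div_assoc, le_div_iff₀ (by positivity)]
    nlinarith [sq_nonneg ‖deriv G z‖]
  rw [lintegral_const_mul' _ _ (by simp)] at h2
  have h3 := (measure_mono hsub).trans (h1.trans (h2.trans (mul_le_mul_right he 37)))
  rw [Complex.volume_ball, show (37 : ENNReal) = ENNReal.ofReal 37 by simp, ← ENNReal.ofReal_mul (by norm_num), 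
    show (NNReal.pi : ENNReal) = ENNReal.ofReal Real.pi by rw [ENNReal.ofReal, Real.toNNReal_of_nonneg Real.pi_pos.le]; rfl, ← ENNReal.ofReal_pow (by norm_num), ← ENNReal.ofReal_mul (by positivity), ENNReal.ofReal_le_ofReal_iff (by norm_num)] at h3
  have := Real.pi_gt_three
  linarith

lemma aux_comb (t0 t1 : Fin 3 → Prop) (h0 : ∀ i j, t0 i → t0 j → i = j)
    (h1 : ∀ i j, t1 i → t1 j → i = j) : ∃ i, ¬ t0 i ∧ ¬ t1 i := by
  by_contra hcon
  have c : ∀ i, t0 i ∨ t1 i := fun i => by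
    by_contra h
    exact hcon ⟨i, not_or.1 h⟩
  have n01 : (0 : Fin 3) ≠ 1 := by decide
  have n02 : (0 : Fin 3) ≠ 2 := by decide
  have n12 : (1 : Fin 3) ≠ 2 := by decide
  rcases c 0 with a | a <;> rcases c 1 with b | b <;> rcases c 2 with d | d
  · exact n01 (h0 _ _ a b)
  · exact n01 (h0 _ _ a b)
  · exact n02 (h0 _ _ a d)
  · exact n12 (h1 _ _ b d)
  · exact n12 (h0 _ _ b d)
  · exact n02 (h1 _ _ a d)
  · exact n01 (h1 _ _ a b)
  · exact n01 (h1 _ _ a b)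

lemma aux_touch (G : ℂ → ℂ) (x : ℝ) (han : ∀ y : ℝ, AnalyticAt ℂ G (x + y * I))
    (he : ∫ y in (-Real.pi)..Real.pi, ‖deriv G (x + y * I)‖ ^ 2 / (1 + ‖G (x + y * I)‖ ^ 2) ^ 2 ≤ 1 / 1000)
    (i j : Fin 3) (y₁ y₂ : ℝ) (h1 : y₁ ∈ Set.Icc (-Real.pi) Real.pi) (h2 : y₂ ∈ Set.Icc (-Real.pi) Real.pi)
    (hi : ‖G (x + y₁ * I) - (i.val : ℂ)‖ < 1 / 4) (hj : ‖G (x + y₂ * I) - (j.val : ℂ)‖ < 1 / 4) : i = j := by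
  have key : |(1 + ‖G (x + y₂ * I)‖ ^ 2)⁻¹ - (1 + ‖G (x + y₁ * I)‖ ^ 2)⁻¹| ≤ 1 / 10 := by
    rcases le_total y₁ y₂ with h | h
    · exact aux_curve G x han he y₁ y₂ h1 h2 h
    · rw [abs_sub_comm]; exact aux_curve G x han he y₂ y₁ h2 h1 h
  have hb : ∀ (w : ℂ) (k : Fin 3), ‖w - (k.val : ℂ)‖ < 1 / 4 → (k.val : ℝ) - 1 / 4 ≤ ‖w‖ ∧ ‖w‖ ≤ k.val + 1 / 4 := by
    intro w k hk
    have a1 := norm_sub_norm_le w (k.val : ℂ)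
    have a2 := norm_sub_norm_le (k.val : ℂ) w
    rw [norm_sub_rev] at a2
    simp only [Complex.norm_natCast] at a1 a2
    constructor <;> linarith
  have hv : ∀ (w : ℂ) (k : Fin 3), ‖w - (k.val : ℂ)‖ < 1 / 4 →
      (k = 0 → 0.9 ≤ (1 + ‖w‖ ^ 2)⁻¹) ∧ (k = 1 → 0.38 ≤ (1 + ‖w‖ ^ 2)⁻¹ ∧ (1 + ‖w‖ ^ 2)⁻¹ ≤ 0.65) ∧
      (k = 2 → (1 + ‖w‖ ^ 2)⁻¹ ≤ 0.25) := by
    intro w k hk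
    obtain ⟨b1, b2⟩ := hb w k hk
    have hn := norm_nonneg w
    have hpos : 0 < 1 + ‖w‖ ^ 2 := by positivity
    refine ⟨?_, ?_, ?_⟩
    · rintro rfl
      norm_num at b1 b2
      rw [le_inv_comm₀ (by norm_num) hpos]; nlinarith
    · rintro rfl
      norm_num at b1 b2
      constructor
      · rw [le_inv_comm₀ (by norm_num) hpos]; nlinarith
      · rw [inv_le_comm₀ hpos (by norm_num)]; nlinarith
    · rintro rfl
      norm_num at b1 b2
      rw [inv_le_comm₀ hpos (by norm_num)]; nlinarith
  obtain ⟨p0, p1, p2⟩ := hv _ i hi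
  obtain ⟨q0, q1, q2⟩ := hv _ j hj
  rw [abs_le] at key
  by_contra hne
  fin_cases i <;> fin_cases j <;> simp at hne p0 p1 p2 q0 q1 q2 <;> norm_num at * <;> linarith

lemma aux_core (G : ℂ → ℂ) (hper : ∀ z, G (z + 2 * Real.pi * I) = G z)
    (hG : ∀ z, AnalyticAt ℂ G z ∨ ((∀ᶠ w in 𝓝[≠] z, AnalyticAt ℂ G w) ∧
      Tendsto G (𝓝[≠] z) (Bornology.cobounded ℂ)))
    (hcount : {z | AnalyticAt ℂ G z}ᶜ.Countable)
    (x₀ x₁ : ℝ)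
    (han0 : ∀ y : ℝ, AnalyticAt ℂ G (x₀ + y * I))
    (he0 : ∫ y in (-Real.pi)..Real.pi, ‖deriv G (x₀ + y * I)‖ ^ 2 / (1 + ‖G (x₀ + y * I)‖ ^ 2) ^ 2 ≤ 1 / 1000)
    (han1 : ∀ y : ℝ, AnalyticAt ℂ G (x₁ + y * I))
    (he1 : ∫ y in (-Real.pi)..Real.pi, ‖deriv G (x₁ + y * I)‖ ^ 2 / (1 + ‖G (x₁ + y * I)‖ ^ 2) ^ 2 ≤ 1 / 1000)
    (he : ∫⁻ z in Set.Ioo x₀ x₁ ×ℂ Set.Ioc (-Real.pi) Real.pi,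
      ENNReal.ofReal (‖deriv G z‖ ^ 2 / (1 + ‖G z‖ ^ 2) ^ 2) ≤ ENNReal.ofReal (1/1000)) :
    ∃ i : Fin 3, ∀ z, AnalyticAt ℂ G z → x₀ < z.re → z.re < x₁ → 1 / 4 ≤ ‖G z - (i.val : ℂ)‖ := by
  classical
  set S : Set ℂ := {z | AnalyticAt ℂ G z} with hS
  have hSo : IsOpen S := isOpen_analyticAt ℂ G
  have hSc : IsPreconnected S := by
    have := (hcount.isPathConnected_compl_of_one_lt_rank (by simp)).isConnected.isPreconnected
    simpa using this
  have hSan : AnalyticOnNhd ℂ G S := fun z hz => hz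
  rcases hSan.is_constant_or_isOpen hSc with ⟨w, hw⟩ | hopen
  · by_cases h : ‖w‖ < 1 / 4
    · refine ⟨1, fun z hz _ _ => ?_⟩
      rw [hw z hz]
      have := norm_sub_norm_le (1:ℂ) w
      rw [norm_sub_rev] at this
      simp at this ⊢; norm_num at *; linarith
    · refine ⟨0, fun z hz _ _ => ?_⟩
      rw [hw z hz]
      simpa using h
  -- choose an untouched ball
  have hred : ∀ z : ℂ, ∃ z' : ℂ, z'.re = z.re ∧ z'.im ∈ Set.Ioc (-Real.pi) Real.pi ∧ G z' = G z ∧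
      (AnalyticAt ℂ G z' ↔ AnalyticAt ℂ G z) := by
    intro z
    have hexp : exp (log (exp z)) = exp z := exp_log (exp_ne_zero z)
    refine ⟨log (exp z), ?_, ⟨neg_pi_lt_log_im _, log_im_le_pi _⟩, aux_per_exp hper hexp, aux_an_exp hper hexp⟩
    rw [log_re, norm_exp, Real.log_exp]
  obtain ⟨i, hi0, hi1⟩ : ∃ i : Fin 3, (∀ y ∈ Set.Icc (-Real.pi) Real.pi, ¬ ‖G (x₀ + y * I) - (i.val : ℂ)‖ < 1 / 4) ∧
      (∀ y ∈ Set.Icc (-Real.pi) Real.pi, ¬ ‖G (x₁ + y * I) - (i.val : ℂ)‖ < 1 / 4) := by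
    set t0 : Fin 3 → Prop := fun i => ∃ y ∈ Set.Icc (-Real.pi) Real.pi, ‖G (x₀ + y * I) - (i.val : ℂ)‖ < 1 / 4
    set t1 : Fin 3 → Prop := fun i => ∃ y ∈ Set.Icc (-Real.pi) Real.pi, ‖G (x₁ + y * I) - (i.val : ℂ)‖ < 1 / 4
    have ht0 : ∀ i j, t0 i → t0 j → i = j := by
      rintro i j ⟨y, hy, h⟩ ⟨y', hy', h'⟩
      exact aux_touch G x₀ han0 he0 i j y y' hy hy' h h'
    have ht1 : ∀ i j, t1 i → t1 j → i = j := by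
      rintro i j ⟨y, hy, h⟩ ⟨y', hy', h'⟩
      exact aux_touch G x₁ han1 he1 i j y y' hy hy' h h'
    have : ∃ i, ¬ t0 i ∧ ¬ t1 i := by
      exact aux_comb t0 t1 ht0 ht1
    obtain ⟨i, h0, h1⟩ := this
    refine ⟨i, fun y hy h => h0 ⟨y, hy, h⟩, fun y hy h => h1 ⟨y, hy, h⟩⟩
  refine ⟨i, ?_⟩
  by_contra hcon
  push Not at hcon
  obtain ⟨z₀, hz₀, hz₀0, hz₀1, hz₀b⟩ := hcon
  set c : ℂ := (i.val : ℂ) with hc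
  set B := Metric.ball c (1/4) with hB
  set A : Set ℂ := {z | x₀ < z.re ∧ z.re < x₁} with hA
  have hAo : IsOpen A := (isOpen_lt continuous_const continuous_re).inter (isOpen_lt continuous_re continuous_const)
  have hTo : IsOpen (G '' (S ∩ A)) := hopen _ Set.inter_subset_left (hSo.inter hAo)
  have hBT : B ⊆ G '' (S ∩ A) := by
    refine (convex_ball c (1/4)).isPreconnected.subset_of_closure_inter_subset hTo
      ⟨G z₀, by simpa [dist_eq_norm] using hz₀b, z₀, ⟨hz₀, hz₀0, hz₀1⟩, rfl⟩ ?_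
    rintro b ⟨hb, hbB⟩
    obtain ⟨u, hu, hub⟩ := mem_closure_iff_seq_limit.1 hb
    have hu' : ∀ k, ∃ z, z ∈ S ∧ z ∈ (Set.Icc x₀ x₁ ×ℂ Set.Icc (-Real.pi) Real.pi) ∧ G z = u k := by
      intro k
      obtain ⟨z, ⟨hzS, hzA⟩, hz⟩ := hu k
      obtain ⟨z', h1, h2, h3, h4⟩ := hred z
      refine ⟨z', h4.2 hzS, ?_, h3.trans hz⟩
      rw [mem_reProdIm, h1]
      exact ⟨⟨hzA.1.le, hzA.2.le⟩, ⟨h2.1.le, h2.2⟩⟩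
    choose ζ hζS hζK hζu using hu'
    obtain ⟨z, hzK, φ, hφ, hlim⟩ := (isCompact_Icc.reProdIm isCompact_Icc).tendsto_subseq hζK
    have hGb : Tendsto (fun k => G (ζ (φ k))) atTop (𝓝 b) := by
      simp only [hζu]
      exact hub.comp hφ.tendsto_atTop
    have hbB' : ‖b - c‖ < 1 / 4 := by simpa [hB, dist_eq_norm] using hbB
    by_cases hz : AnalyticAt ℂ G z
    · have hGz : G z = b := tendsto_nhds_unique (hz.continuousAt.tendsto.comp hlim) hGb
      rw [mem_reProdIm] at hzK
      have hzeq : z = z.re + z.im * I := (re_add_im z).symm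
      refine ⟨z, ⟨hz, lt_of_le_of_ne hzK.1.1 ?_, lt_of_le_of_ne hzK.1.2 ?_⟩, hGz⟩
      · intro h
        apply hi0 z.im hzK.2
        rw [h, re_add_im, hGz]; exact hbB'
      · intro h
        apply hi1 z.im hzK.2
        rw [← h, re_add_im, hGz]; exact hbB'
    · exfalso
      have h1 : Tendsto (fun k => ζ (φ k)) atTop (𝓝[≠] z) := by
        refine tendsto_nhdsWithin_iff.2 ⟨hlim, Eventually.of_forall fun k h => hz ?_⟩
        have : ζ (φ k) = z := h
        rw [← this]; exact hζS _
      have h2 := ((hG z).resolve_left hz).2.comp h1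
      have h3 := Metric.disjoint_nhds_cobounded b
      have := tendsto_inf.2 ⟨hGb, h2⟩
      rw [h3.eq_bot] at this
      exact (this.neBot).ne rfl
  set D : Set ℂ := S ∩ (Set.Ioo x₀ x₁ ×ℂ Set.Ioc (-Real.pi) Real.pi) ∩ (S ∩ G ⁻¹' B) with hD
  have hrm : MeasurableSet (Set.Ioo x₀ x₁ ×ℂ Set.Ioc (-Real.pi) Real.pi) :=
    (measurable_re measurableSet_Ioo).inter (measurable_im measurableSet_Ioc)
  refine aux_area G c ?_ D ?_ ?_ ?_ ?_ ?_
  · rw [hc, Complex.norm_natCast]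
    have := i.2
    have : i.val ≤ 2 := by omega
    exact_mod_cast this
  · refine (hSo.measurableSet.inter hrm).inter ?_
    have : ContinuousOn G S := fun z hz => (hSan z hz).continuousAt.continuousWithinAt
    exact (this.isOpen_inter_preimage hSo Metric.isOpen_ball).measurableSet
  · exact fun z hz => hz.1.1
  · exact fun z hz => hz.2.2
  · intro b hb
    obtain ⟨z, ⟨hzS, hzA⟩, hz⟩ := hBT hb
    obtain ⟨z', h1, h2, h3, h4⟩ := hred z
    refine ⟨z', ⟨⟨h4.2 hzS, ?_⟩, h4.2 hzS, ?_⟩, h3.trans hz⟩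
    · rw [mem_reProdIm, h1]; exact ⟨⟨hzA.1, hzA.2⟩, h2⟩
    · rw [Set.mem_preimage, h3, hz]; exact hb
  · refine (lintegral_mono_set ?_).trans he
    exact fun z hz => hz.1.2

lemma aux_fin (G : ℂ → ℂ) (henergy : MeasureTheory.IntegrableOn
      (fun p : ℝ × ℝ =>
        ‖deriv G (p.1 + p.2 * Complex.I)‖ ^ 2 /
          (1 + ‖G (p.1 + p.2 * Complex.I)‖ ^ 2) ^ 2)
      (Set.univ ×ˢ Set.Ioo (-Real.pi) Real.pi)) :
    ∃ X : ℝ, ∀ K : Set ℂ, (∀ z ∈ K, X < |z.re| ∧ z.im ∈ Set.Ioc (-Real.pi) Real.pi) →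
      ∫⁻ z in K, ENNReal.ofReal (‖deriv G z‖ ^ 2 / (1 + ‖G z‖ ^ 2) ^ 2) ≤ ENNReal.ofReal (1/1000) := by
  have hae : (Set.univ ×ˢ Set.Ioc (-Real.pi) Real.pi : Set (ℝ × ℝ)) =ᵐ[volume] (Set.univ ×ˢ Set.Ioo (-Real.pi) Real.pi : Set (ℝ × ℝ)) := by
    rw [Measure.volume_eq_prod]
    exact Measure.set_prod_ae_eq (ae_eq_refl _) Ioo_ae_eq_Ioc.symm
  have h1 := henergy.congr_set_ae hae
  have h2 : ∫⁻ p in (Set.univ ×ˢ Set.Ioc (-Real.pi) Real.pi : Set (ℝ × ℝ)), ENNReal.ofReal (‖deriv G (p.1 + p.2 * Complex.I)‖ ^ 2 /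
          (1 + ‖G (p.1 + p.2 * Complex.I)‖ ^ 2) ^ 2) < ⊤ :=
    h1.lintegral_lt_top
  set f : ℂ → ENNReal := fun z => ENNReal.ofReal (‖deriv G z‖ ^ 2 / (1 + ‖G z‖ ^ 2) ^ 2) with hf
  set st : Set ℂ := {z | z.im ∈ Set.Ioc (-Real.pi) Real.pi} with hst
  have hstm : MeasurableSet st := measurable_im measurableSet_Ioc
  have h3 : ∫⁻ z in st, f z < ⊤ := by
    have e := volume_preserving_equiv_real_prod.setLIntegral_comp_preimage_emb
      measurableEquivRealProd.measurableEmbedding (fun p : ℝ × ℝ => ENNReal.ofReal (‖deriv G (p.1 + p.2 * Complex.I)‖ ^ 2 /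
          (1 + ‖G (p.1 + p.2 * Complex.I)‖ ^ 2) ^ 2)) (Set.univ ×ˢ Set.Ioc (-Real.pi) Real.pi)
    rw [← e] at h2
    have e1 : measurableEquivRealProd ⁻¹' (Set.univ ×ˢ Set.Ioc (-Real.pi) Real.pi) = st := by
      ext z; simp [hst, measurableEquivRealProd_apply]
    rw [e1] at h2
    simpa only [measurableEquivRealProd_apply, re_add_im] using h2
  set ν := (volume.restrict st).withDensity f with hν
  have hνu : ν Set.univ < ⊤ := by rw [hν, withDensity_apply _ MeasurableSet.univ]; simpa using h3
  set K : ℕ → Set ℂ := fun n => {z | (n : ℝ) < |z.re|} with hK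
  have hKm : ∀ n, MeasurableSet (K n) := fun n =>
    measurableSet_lt measurable_const (continuous_re.abs.measurable)
  have ht := tendsto_measure_iInter_atTop (μ := ν) (s := K) (fun n => (hKm n).nullMeasurableSet)
    (fun n m hnm z hz => by
      have h1 : (m : ℝ) < |z.re| := hz
      have h2 : (n : ℝ) ≤ m := Nat.cast_le.2 hnm
      exact lt_of_le_of_lt h2 h1)
    ⟨0, ((measure_mono (Set.subset_univ _)).trans_lt hνu).ne⟩
  have hKi : ⋂ n, K n = ∅ := by
    ext z
    simp only [Set.mem_iInter, Set.mem_empty_iff_false, iff_false, not_forall]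
    obtain ⟨n, hn⟩ := exists_nat_gt |z.re|
    exact ⟨n, fun h => lt_asymm hn h⟩
  rw [hKi, measure_empty] at ht
  obtain ⟨n, hn⟩ := (ht.eventually_lt_const (show (0 : ENNReal) < ENNReal.ofReal (1/1000) by simp)).exists
  refine ⟨n, fun L hL => le_trans ?_ hn.le⟩
  rw [Function.comp_apply, hν, withDensity_apply _ (hKm n), Measure.restrict_restrict (hKm n)]
  exact lintegral_mono_set fun z hz => ⟨(hL z hz).1, (hL z hz).2⟩

lemma aux_good (G : ℂ → ℂ) (hcount : {z | AnalyticAt ℂ G z}ᶜ.Countable)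
    (henergy : MeasureTheory.IntegrableOn
      (fun p : ℝ × ℝ =>
        ‖deriv G (p.1 + p.2 * Complex.I)‖ ^ 2 /
          (1 + ‖G (p.1 + p.2 * Complex.I)‖ ^ 2) ^ 2)
      (Set.univ ×ˢ Set.Ioo (-Real.pi) Real.pi)) (T : Set ℝ) (hT : volume T = ⊤) :
    ∃ x ∈ T, (∀ y : ℝ, AnalyticAt ℂ G (x + y * I)) ∧
      ∫ y in (-Real.pi)..Real.pi, ‖deriv G (x + y * I)‖ ^ 2 / (1 + ‖G (x + y * I)‖ ^ 2) ^ 2 ≤ 1 / 1000 := by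
  have h1 := henergy
  rw [IntegrableOn, Measure.volume_eq_prod, ← Measure.prod_restrict, Measure.restrict_univ] at h1
  have h2 := h1.integral_prod_left
  have h3 := h2.measure_norm_ge_lt_top (ε := 1/1000) (by norm_num)
  set N : Set ℝ := re '' {z | AnalyticAt ℂ G z}ᶜ with hN
  have hN0 : volume N = 0 := (hcount.image _).measure_zero _
  by_contra hcon
  push Not at hcon
  have hsub : T ⊆ {x : ℝ | 1/1000 ≤ ‖∫ y in Set.Ioo (-Real.pi) Real.pi, ‖deriv G (x + y * I)‖ ^ 2 / (1 + ‖G (x + y * I)‖ ^ 2) ^ 2‖} ∪ N := by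
    intro x hx
    by_cases hxN : x ∈ N
    · exact Or.inr hxN
    left
    have := hcon x hx (fun y => by
      by_contra hy
      exact hxN ⟨x + y * I, hy, by simp⟩)
    rw [intervalIntegral.integral_of_le (by linarith [Real.pi_pos]), integral_Ioc_eq_integral_Ioo] at this
    exact this.le.trans (Real.le_norm_self _)
  have := (measure_mono (μ := volume) hsub).trans (measure_union_le _ _)
  rw [hT, hN0, add_zero, top_le_iff] at this
  exact h3.ne this

lemma aux_ends (G : ℂ → ℂ) (hper : ∀ z, G (z + 2 * Real.pi * I) = G z)
    (hG : ∀ z, AnalyticAt ℂ G z ∨ ((∀ᶠ w in 𝓝[≠] z, AnalyticAt ℂ G w) ∧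
      Tendsto G (𝓝[≠] z) (Bornology.cobounded ℂ)))
    (hcount : {z | AnalyticAt ℂ G z}ᶜ.Countable)
    (henergy : MeasureTheory.IntegrableOn
      (fun p : ℝ × ℝ =>
        ‖deriv G (p.1 + p.2 * Complex.I)‖ ^ 2 /
          (1 + ‖G (p.1 + p.2 * Complex.I)‖ ^ 2) ^ 2)
      (Set.univ ×ˢ Set.Ioo (-Real.pi) Real.pi)) :
    (∃ (c : ℂ) (x₀ : ℝ), ∀ z, AnalyticAt ℂ G z → x₀ < z.re → 1 / 4 ≤ ‖G z - c‖) ∧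
    (∃ (c : ℂ) (x₀ : ℝ), ∀ z, AnalyticAt ℂ G z → z.re < x₀ → 1 / 4 ≤ ‖G z - c‖) := by
  obtain ⟨X, hX⟩ := aux_fin G henergy
  constructor
  · obtain ⟨x₀, hx₀, ha0, he0⟩ := aux_good G hcount henergy (Set.Ioi X) Real.volume_Ioi
    by_contra hcon
    push Not at hcon
    choose ζ hζ1 hζ2 hζ3 using fun i : Fin 3 => hcon (i.val : ℂ) x₀
    obtain ⟨x₁, hx₁, ha1, he1⟩ := aux_good G hcount henergy
      (Set.Ioi (max (max (ζ 0).re (ζ 1).re) (ζ 2).re)) Real.volume_Ioi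
    have hx₁' : ∀ i, (ζ i).re < x₁ := by
      simp only [Set.mem_Ioi, max_lt_iff] at hx₁
      intro i; fin_cases i
      exacts [hx₁.1.1, hx₁.1.2, hx₁.2]
    obtain ⟨i, hi⟩ := aux_core G hper hG hcount x₀ x₁ ha0 he0 ha1 he1 (hX _ (by
      rintro z ⟨hz1, hz2⟩
      exact ⟨lt_of_lt_of_le (lt_trans hx₀ hz1.1) (le_abs_self _), hz2⟩))
    exact absurd (hi (ζ i) (hζ1 i) (hζ2 i) (hx₁' i)) (not_le.2 (hζ3 i))
  · obtain ⟨x₀, hx₀, ha0, he0⟩ := aux_good G hcount henergy (Set.Iio (-X)) Real.volume_Iio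
    by_contra hcon
    push Not at hcon
    choose ζ hζ1 hζ2 hζ3 using fun i : Fin 3 => hcon (i.val : ℂ) x₀
    obtain ⟨x₁, hx₁, ha1, he1⟩ := aux_good G hcount henergy
      (Set.Iio (min (min (ζ 0).re (ζ 1).re) (ζ 2).re)) Real.volume_Iio
    have hx₁' : ∀ i, x₁ < (ζ i).re := by
      simp only [Set.mem_Iio, lt_min_iff] at hx₁
      intro i; fin_cases i
      exacts [hx₁.1.1, hx₁.1.2, hx₁.2]
    obtain ⟨i, hi⟩ := aux_core G hper hG hcount x₁ x₀ ha1 he1 ha0 he0 (hX _ (by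
      rintro z ⟨hz1, hz2⟩
      refine ⟨lt_of_lt_of_le ?_ (neg_le_abs _), hz2⟩
      have h1 : z.re < x₀ := hz1.2
      have h2 : x₀ < -X := hx₀
      linarith))
    exact absurd (hi (ζ i) (hζ1 i) (hx₁' i) (hζ2 i)) (not_le.2 (hζ3 i))

lemma aux_main_nf (G : ℂ → ℂ) (hNF : MeromorphicNFOn G Set.univ)
    (hper : ∀ z, G (z + 2 * Real.pi * I) = G z)
    (henergy : MeasureTheory.IntegrableOn
      (fun p : ℝ × ℝ =>
        ‖deriv G (p.1 + p.2 * Complex.I)‖ ^ 2 /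
          (1 + ‖G (p.1 + p.2 * Complex.I)‖ ^ 2) ^ 2)
      (Set.univ ×ˢ Set.Ioo (-Real.pi) Real.pi)) :
    ∃ P Q : Polynomial ℂ, P ≠ 0 ∧ ∀ z, G z * P.eval (exp z) = Q.eval (exp z) := by
  have hmer : Meromorphic G := fun z => (hNF (Set.mem_univ z)).meromorphicAt
  have hcount : {z | AnalyticAt ℂ G z}ᶜ.Countable := hmer.countable_compl_analyticAt
  have hG : ∀ z, AnalyticAt ℂ G z ∨ ((∀ᶠ w in 𝓝[≠] z, AnalyticAt ℂ G w) ∧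
      Tendsto G (𝓝[≠] z) (Bornology.cobounded ℂ)) := by
    intro z
    rcases meromorphicNFAt_iff_analyticAt_or.1 (hNF (Set.mem_univ z)) with h | h
    · exact Or.inl h
    · exact Or.inr ⟨(hmer z).eventually_analyticAt, tendsto_cobounded_of_meromorphicOrderAt_neg h.2.1⟩
  obtain ⟨⟨c1, x1, h1⟩, ⟨c0, x0, h0⟩⟩ := aux_ends G hper hG hcount henergy
  have hm0 := aux_end_mero hper hG c0 (1/4) x0 (by norm_num) h0
  have hneg : ∀ z, AnalyticAt ℂ (fun z => G (-z)) z ↔ AnalyticAt ℂ G (-z) := by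
    intro z
    constructor
    · intro h
      have := h.fun_comp_of_eq (f := fun z : ℂ => -z) (x := -z) (by fun_prop) (by simp)
      simpa using this
    · intro h
      exact h.fun_comp_of_eq (f := fun z : ℂ => -z) (x := z) (by fun_prop) rfl
  have hpern : ∀ z, (fun z => G (-z)) (z + 2 * Real.pi * I) = (fun z => G (-z)) z := by
    intro z
    have := hper (-(z + 2 * Real.pi * I))
    simp only
    rw [← this]; congr 1; ring
  have htneg : ∀ z : ℂ, Tendsto (fun z : ℂ => -z) (𝓝[≠] z) (𝓝[≠] (-z)) := by
    intro z
    refine tendsto_nhdsWithin_iff.2 ⟨(continuous_neg.tendsto z).mono_left nhdsWithin_le_nhds, ?_⟩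
    filter_upwards [self_mem_nhdsWithin] with w hw
    simpa using hw
  have hm1 := aux_end_mero hpern (by
    intro z
    rcases hG (-z) with h | h
    · exact Or.inl ((hneg z).2 h)
    · refine Or.inr ⟨?_, h.2.comp (htneg z)⟩
      filter_upwards [(htneg z).eventually h.1] with w hw
      exact (hneg w).2 hw) c1 (1/4) (-x1) (by norm_num) (by
    intro z hz hz'
    exact h1 (-z) ((hneg z).1 hz) (by simp; linarith))
  obtain ⟨P, Q, hP, hPQ⟩ := aux_rational (fun w => G (log w)) (by
      intro w
      by_cases hw : w = 0
      · rw [hw]; exact hm0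
      · exact aux_desc_mero hper hw (hmer _)) (by
      refine hm1.congr ?_
      filter_upwards [self_mem_nhdsWithin] with w hw
      have hw : w ≠ 0 := hw
      apply aux_per_exp hper
      rw [exp_neg, exp_log hw, exp_log (inv_ne_zero hw)])
  refine ⟨P, Q, hP, fun z => ?_⟩
  rw [← hPQ, aux_per_exp hper (a := z) (b := log (exp z)) (by rw [exp_log (exp_ne_zero z)])]

lemma aux_main (W : ℂ → ℂ) (hW : MeromorphicOn W Set.univ)
    (hper : ∀ z : ℂ, W (z + 2 * Real.pi * Complex.I) = W z)
    (henergy : MeasureTheory.IntegrableOn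
      (fun p : ℝ × ℝ =>
        ‖deriv W (p.1 + p.2 * Complex.I)‖ ^ 2 /
          (1 + ‖W (p.1 + p.2 * Complex.I)‖ ^ 2) ^ 2)
      (Set.univ ×ˢ Set.Ioo (-Real.pi) Real.pi)) :
    ∃ P Q : Polynomial ℂ, P ≠ 0 ∧ ∀ z, AnalyticAt ℂ W z → W z * P.eval (exp z) = Q.eval (exp z) := by
  set G := toMeromorphicNFOn W Set.univ with hGdef
  have hNF : MeromorphicNFOn G Set.univ := meromorphicNFOn_toMeromorphicNFOn W Set.univ
  have heq : ∀ z, AnalyticAt ℂ W z → G z = W z := by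
    intro z hz
    rw [hGdef, toMeromorphicNFOn_eq_toMeromorphicNFAt hW (Set.mem_univ z),
      toMeromorphicNFAt_eq_self.2 hz.meromorphicNFAt]
  have heq' : ∀ z, AnalyticAt ℂ W z → G =ᶠ[𝓝 z] W := fun z hz =>
    hz.eventually_analyticAt.mono fun w hw => heq w hw
  have hne : ∀ z, G =ᶠ[𝓝[≠] z] W := fun z => hW.toMeromorphicNFOn_eq_self_on_nhdsNE (Set.mem_univ z)
  have hGper : ∀ z, G (z + 2 * Real.pi * I) = G z := by
    intro z
    have hN1 : MeromorphicNFAt (fun z => G (z + 2 * Real.pi * I)) z :=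
      meromorphicNFAt_comp_add_const_iff_meromorphicNFAt.2 (hNF (Set.mem_univ _))
    have htt : Tendsto (fun z : ℂ => z + 2 * Real.pi * I) (𝓝[≠] z) (𝓝[≠] (z + 2 * Real.pi * I)) := by
      refine tendsto_nhdsWithin_iff.2 ⟨?_, ?_⟩
      · exact ((continuous_id.add continuous_const).tendsto z).mono_left nhdsWithin_le_nhds
      · filter_upwards [self_mem_nhdsWithin] with w hw
        simpa using hw
    have h2 : (fun z => G (z + 2 * Real.pi * I)) =ᶠ[𝓝[≠] z] G := by
      filter_upwards [htt.eventually (hne (z + 2 * Real.pi * I)), hne z] with w h1 h2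
      rw [h1, h2, hper]
    exact ((hN1.eventuallyEq_nhdsNE_iff_eventuallyEq_nhds (hNF (Set.mem_univ z))).1 h2).eq_of_nhds
  have hcount : {z | AnalyticAt ℂ W z}ᶜ.Countable :=
    (meromorphicOn_univ.1 hW).countable_compl_analyticAt
  have hae : ∀ᵐ p : ℝ × ℝ, AnalyticAt ℂ W (p.1 + p.2 * I) := by
    have : {p : ℝ × ℝ | ¬ AnalyticAt ℂ W (p.1 + p.2 * I)}.Countable := by
      refine hcount.preimage_of_injOn (f := fun p : ℝ × ℝ => (p.1 + p.2 * I : ℂ)) ?_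
      rintro ⟨a, b⟩ _ ⟨c, d⟩ _ h
      have h1 := congrArg re h
      have h2 := congrArg im h
      simp at h1 h2
      rw [h1, h2]
    rw [ae_iff]
    exact this.measure_zero _
  obtain ⟨P, Q, hP, h⟩ := aux_main_nf G hNF hGper (by
    refine henergy.congr (ae_restrict_of_ae ?_)
    filter_upwards [hae] with p hp
    rw [heq _ hp, (heq' _ hp).deriv_eq])
  exact ⟨P, Q, hP, fun z hz => by rw [← heq z hz]; exact h z⟩

/-- **Factorization of periodic meromorphic maps of finite Dirichlet energy through `exp`.**
If `W : ℂ → ℂ` is meromorphic on all of `ℂ`, periodic with period `2πi`, and has finite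
Dirichlet energy on the cylinder (i.e. on the strip `ℝ × (−π, π)`), then there is a unique
rational function `R` with `W z = R (exp z)` for all `z` outside the discrete bad set
(poles of `W`, and points where `exp z` is a pole of `R`). -/
theorem cp1_lumps_factorization_through_exp
    (W : ℂ → ℂ) (hW : MeromorphicOn W Set.univ)
    (hper : ∀ z : ℂ, W (z + 2 * Real.pi * Complex.I) = W z)
    (henergy : MeasureTheory.IntegrableOn
      (fun p : ℝ × ℝ =>
        ‖deriv W (p.1 + p.2 * Complex.I)‖ ^ 2 /
          (1 + ‖W (p.1 + p.2 * Complex.I)‖ ^ 2) ^ 2)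
      (Set.univ ×ˢ Set.Ioo (-Real.pi) Real.pi)) :
    ∃! R : RatFunc ℂ, ∀ z : ℂ, AnalyticAt ℂ W z →
      Polynomial.eval (Complex.exp z) R.denom ≠ 0 →
      W z = RatFunc.eval (RingHom.id ℂ) (Complex.exp z) R := by
  have hcount : {z | AnalyticAt ℂ W z}ᶜ.Countable :=
    (meromorphicOn_univ.1 hW).countable_compl_analyticAt
  obtain ⟨P, Q, hP, hPQ⟩ := aux_main W hW hper henergy
  have hinj := RatFunc.algebraMap_injective (K := ℂ)
  refine ⟨algebraMap _ (RatFunc ℂ) Q / algebraMap _ (RatFunc ℂ) P, ?_, ?_⟩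
  · intro z hz hden
    set R : RatFunc ℂ := algebraMap _ (RatFunc ℂ) Q / algebraMap _ (RatFunc ℂ) P with hR
    have hrel : R.num * P = Q * R.denom := by
      apply hinj
      have h1 := RatFunc.num_div_denom R
      have h2 : algebraMap _ (RatFunc ℂ) R.denom ≠ 0 := by
        simpa using R.denom_ne_zero
      have h3 : algebraMap _ (RatFunc ℂ) P ≠ 0 := by simpa using hP
      rw [map_mul, map_mul, ← div_eq_div_iff h2 h3, h1]
    have hev : ∀ᶠ u in 𝓝 z, AnalyticAt ℂ W u ∧ R.denom.eval (exp u) ≠ 0 := by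
      refine hz.eventually_analyticAt.and ?_
      have : Continuous fun u => R.denom.eval (exp u) := R.denom.continuous.comp continuous_exp
      exact this.continuousAt.eventually_ne hden
    have hPan : AnalyticAt ℂ (fun u => P.eval (exp u)) z :=
      AnalyticAt.fun_comp_of_eq (g := fun w => P.eval w) (f := exp)
        (AnalyticOnNhd.eval_polynomial P (exp z) trivial) (by fun_prop) rfl
    have hPne : ∃ᶠ u in 𝓝 z, P.eval (exp u) ≠ 0 := by
      intro hcon
      push Not at hcon
      apply hP
      obtain ⟨ε, hε, hb⟩ := Metric.eventually_nhds_iff.1 hcon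
      have hopen : IsOpen (exp '' Metric.ball z ε) := Complex.isOpenMap_exp _ Metric.isOpen_ball
      have hinf : (exp '' Metric.ball z ε).Infinite :=
        infinite_of_mem_nhds (exp z) (hopen.mem_nhds ⟨z, Metric.mem_ball_self hε, rfl⟩)
      refine Polynomial.eq_zero_of_infinite_isRoot P (hinf.mono ?_)
      rintro _ ⟨u, hu, rfl⟩
      exact hb hu
    have hfr : ∃ᶠ u in 𝓝 z, W u * R.denom.eval (exp u) - R.num.eval (exp u) = 0 := by
      refine (hPne.and_eventually hev).mono ?_
      rintro u ⟨h1, h2, h3⟩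
      have h4 := hPQ u h2
      have h5 := congrArg (Polynomial.eval (exp u)) hrel
      rw [Polynomial.eval_mul, Polynomial.eval_mul] at h5
      apply mul_right_cancel₀ h1
      rw [zero_mul, sub_mul, h5, ← h4]; ring
    have hcont : ContinuousAt (fun u => W u * R.denom.eval (exp u) - R.num.eval (exp u)) z :=
      (hz.continuousAt.mul (R.denom.continuous.comp continuous_exp).continuousAt).sub
        (R.num.continuous.comp continuous_exp).continuousAt
    have hzero : W z * R.denom.eval (exp z) - R.num.eval (exp z) = 0 := by
      by_contra hne
      exact hfr (hcont.eventually_ne hne)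
    rw [RatFunc.eval, eq_div_iff (by simpa using hden)]
    simpa [sub_eq_zero] using hzero
  · intro R' hR'
    set R : RatFunc ℂ := algebraMap _ (RatFunc ℂ) Q / algebraMap _ (RatFunc ℂ) P with hR
    have h2 : algebraMap _ (RatFunc ℂ) R'.denom ≠ 0 := by
      simpa using R'.denom_ne_zero
    have h3 : algebraMap _ (RatFunc ℂ) P ≠ 0 := by simpa using hP
    rw [← RatFunc.num_div_denom R', hR, div_eq_div_iff h2 h3, ← map_mul, ← map_mul]
    congr 1
    apply Polynomial.eq_of_infinite_eval_eq
    set bad : Set ℂ := exp '' {z | AnalyticAt ℂ W z}ᶜ ∪ ({0} ∪ {w | R'.denom.IsRoot w}) with hbad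
    have hbadc : bad.Countable := by
      refine (hcount.image _).union ((Set.countable_singleton _).union ?_)
      exact (Polynomial.finite_setOf_isRoot R'.denom_ne_zero).countable
    have hinf : badᶜ.Infinite := by
      intro hfin
      have := hbadc.union hfin.countable
      rw [Set.union_compl_self] at this
      exact not_countable_complex this
    refine hinf.mono ?_
    intro w hw
    simp only [hbad, Set.mem_compl_iff, Set.mem_union, not_or, Set.mem_singleton_iff, Set.mem_setOf_eq] at hw
    obtain ⟨a1, a2, a3⟩ := hw
    have hexp : exp (log w) = w := exp_log a2
    have han : AnalyticAt ℂ W (log w) := by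
      by_contra h
      exact a1 ⟨log w, h, hexp⟩
    have e1 := hR' (log w) han (by rw [hexp]; exact a3)
    have e2 := hPQ (log w) han
    rw [hexp] at e1 e2
    rw [RatFunc.eval, eq_div_iff (by simpa using a3)] at e1
    simp only [Polynomial.eval₂_id] at e1
    simp only [Set.mem_setOf_eq, Polynomial.eval_mul]
    rw [← e1, ← e2]; ring
end

section
/- Define K(k) := ∫₀^{π/2} (1 − k² sin²θ)^{−1/2} dθ for 0 ≤ k < 1, and for t > 0 define f(t) := ∫₀¹ ( 1/(k+t) + 1/(1+tk) ) K(k) dk (the integrand is Lebesgue-integrable on (0,1) for every t > 0). Then f is real-analytic on (0, ∞), and it satisfies the closed form f(t) = (π/2) K(√(1−t²)) for 0 < t ≤ 1 and f(t) = (π/(2t)) K(√(1−t^{−2})) for t > 1. -/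
open MeasureTheory intervalIntegral

/-- Legendre's complete elliptic integral of the first kind. -/
noncomputable def ellipticK (k : ℝ) : ℝ :=
  ∫ θ in (0:ℝ)..(Real.pi / 2), 1 / Real.sqrt (1 - k ^ 2 * Real.sin θ ^ 2)

/-- The auxiliary integral `f(t) = ∫₀¹ (1/(k+t) + 1/(1+tk)) K(k) dk`. -/
noncomputable def ellipticF (t : ℝ) : ℝ :=
  ∫ k in (0:ℝ)..1, (1 / (k + t) + 1 / (1 + t * k)) * ellipticK k

open Real
noncomputable def ellG (x : ℝ) : ℝ :=
  ∫ θ in (0:ℝ)..(Real.pi / 2), 1 / Real.sqrt (Real.cos θ ^ 2 + x ^ 2 * Real.sin θ ^ 2)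

lemma ellK_eq_G (x : ℝ) (h0 : 0 ≤ x) (h1 : x ≤ 1) : ellipticK (√(1 - x ^ 2)) = ellG x := by
  unfold ellipticK ellG
  congr 1
  ext θ
  rw [Real.sq_sqrt (by nlinarith)]
  congr 2
  nlinarith [Real.sin_sq_add_cos_sq θ]

lemma integral_cs (a b : ℝ) (ha : 0 < a) (hb : 0 < b) :
    ∫ θ in (0:ℝ)..(Real.pi / 2), 1 / (a ^ 2 * cos θ ^ 2 + b ^ 2 * sin θ ^ 2) = π / 2 / (a * b) := by
  have pos : ∀ θ : ℝ, ∀ a b : ℝ, 0 < a → 0 < b → 0 < a * cos θ ^ 2 + b * sin θ ^ 2 := by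
    intro θ a b ha hb
    rcases le_total a b with h | h
    · nlinarith [sin_sq_add_cos_sq θ, sq_nonneg (sin θ), sq_nonneg (cos θ), mul_nonneg (sub_nonneg.2 h) (sq_nonneg (sin θ))]
    · nlinarith [sin_sq_add_cos_sq θ, sq_nonneg (sin θ), sq_nonneg (cos θ), mul_nonneg (sub_nonneg.2 h) (sq_nonneg (cos θ))]
  have hd : ∀ θ : ℝ, HasDerivAt (fun θ => (θ + arctan ((b - a) * (sin θ * cos θ) / (a * cos θ ^ 2 + b * sin θ ^ 2))) / (a * b))
      (1 / (a ^ 2 * cos θ ^ 2 + b ^ 2 * sin θ ^ 2)) θ := by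
    intro θ
    have p1 := pos θ a b ha hb
    have p2 := pos θ (a^2) (b^2) (by positivity) (by positivity)
    have h1 : HasDerivAt (fun θ => (b - a) * (sin θ * cos θ)) ((b - a) * (cos θ * cos θ + sin θ * (- sin θ))) θ :=
      ((hasDerivAt_sin θ).mul (hasDerivAt_cos θ)).const_mul _
    have h2 : HasDerivAt (fun θ => a * cos θ ^ 2 + b * sin θ ^ 2)
       (a * (2 * cos θ ^ 1 * (- sin θ)) + b * (2 * sin θ ^ 1 * cos θ)) θ := by
      exact (((hasDerivAt_cos θ).fun_pow 2).const_mul a).add (((hasDerivAt_sin θ).fun_pow 2).const_mul b) |>.congr_deriv (by simp)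
    have h3 := (((hasDerivAt_id θ).add ((h1.div h2 p1.ne').arctan)).div_const (a * b))
    refine h3.congr_deriv ?_
    have key : 1 + ((b - a) * (sin θ * cos θ) / (a * cos θ ^ 2 + b * sin θ ^ 2)) ^ 2
      = (a ^ 2 * cos θ ^ 2 + b ^ 2 * sin θ ^ 2) / (a * cos θ ^ 2 + b * sin θ ^ 2) ^ 2 := by
      field_simp
      have := sin_sq_add_cos_sq θ
      have hs : sin θ ^ 2 = 1 - cos θ ^ 2 := by linarith
      linear_combination (exp := 1) (a ^ 2 * cos θ ^ 2 + b ^ 2 * sin θ ^ 2) * this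
    have key' : 1 + (((fun θ => (b - a) * (sin θ * cos θ)) / (fun θ => a * cos θ ^ 2 + b * sin θ ^ 2)) θ) ^ 2
      = (a ^ 2 * cos θ ^ 2 + b ^ 2 * sin θ ^ 2) / (a * cos θ ^ 2 + b * sin θ ^ 2) ^ 2 := key
    rw [key']
    field_simp
    have := sin_sq_add_cos_sq θ
    have hs : sin θ ^ 2 = 1 - cos θ ^ 2 := by linarith
    ring_nf
    simp only [show sin θ ^ 4 = (sin θ ^ 2) ^ 2 by ring, hs]
    ring
  rw [intervalIntegral.integral_eq_sub_of_hasDerivAt (fun θ _ => hd θ)]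
  · simp
  · apply Continuous.intervalIntegrable
    refine continuous_const.div (by fun_prop) fun θ => (pos θ (a^2) (b^2) (by positivity) (by positivity)).ne'

lemma landen (k : ℝ) (h0 : 0 ≤ k) (h1 : k < 1) : ellG ((1 - k) / (1 + k)) = (1 + k) * ellipticK k := by
  have hden : ∀ θ : ℝ, 0 < 1 + k * sin θ ^ 2 := fun θ => by positivity
  have hs1 : ∀ θ : ℝ, sin θ ^ 2 ≤ 1 := sin_sq_le_one
  have hp : ∀ θ : ℝ, 0 < 1 - k * sin θ ^ 2 := fun θ => by nlinarith [hs1 θ, sq_nonneg (sin θ)]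
  have hp2 : ∀ θ : ℝ, 0 < 1 - k ^ 2 * sin θ ^ 2 := fun θ => by nlinarith [hden θ, hp θ, hs1 θ, sq_nonneg (sin θ), mul_pos (hden θ) (hp θ), mul_nonneg (mul_nonneg h0 h0) (mul_nonneg (sq_nonneg (sin θ)) (sub_nonneg.2 (hs1 θ)))]
  let w : ℝ → ℝ := fun θ => (1 + k) * sin θ / (1 + k * sin θ ^ 2)
  have hw : ∀ θ, 1 - w θ ^ 2 = cos θ ^ 2 * (1 - k ^ 2 * sin θ ^ 2) / (1 + k * sin θ ^ 2) ^ 2 := by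
    intro θ
    have := (hden θ).ne'
    simp only [w]
    field_simp
    rw [cos_sq']; ring
  have hwc : Continuous w := by
    refine Continuous.div (by fun_prop) (by fun_prop) fun θ => (hden θ).ne'
  have := intervalIntegral.integral_comp_mul_deriv'' (a := 0) (b := π / 2) (f := fun θ => arcsin (w θ))
    (f' := fun θ => (1 + k) * (1 - k * sin θ ^ 2) / ((1 + k * sin θ ^ 2) * √(1 - k ^ 2 * sin θ ^ 2)))
    (g := fun φ => 1 / √(cos φ ^ 2 + ((1 - k) / (1 + k)) ^ 2 * sin φ ^ 2))
    (by fun_prop) ?_ ?_ ?_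
  · have e0 : arcsin (w 0) = 0 := by simp [w]
    have e1 : arcsin (w (π / 2)) = π / 2 := by
      have : w (π / 2) = 1 := by simp [w]; positivity
      rw [this, arcsin_one]
    simp only [e0, e1] at this
    unfold ellG
    rw [← this]
    unfold ellipticK
    rw [← intervalIntegral.integral_const_mul]
    apply intervalIntegral.integral_congr
    intro θ hθ
    simp only [Function.comp]
    have hl : -1 ≤ w θ ∧ w θ ≤ 1 := by
      have : 0 ≤ 1 - w θ ^ 2 := by
        rw [hw]; have := hp2 θ; positivity
      constructor <;> nlinarith
    have : cos (arcsin (w θ)) ^ 2 + ((1 - k) / (1 + k)) ^ 2 * sin (arcsin (w θ)) ^ 2 = ((1 - k * sin θ ^ 2) / (1 + k * sin θ ^ 2)) ^ 2 := by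
      rw [cos_sq', sin_arcsin hl.1 hl.2]
      have := (hden θ).ne'
      simp only [w]
      field_simp
      ring
    rw [this, Real.sqrt_sq (div_nonneg (hp θ).le (hden θ).le)]
    have a1 := (hden θ).ne'
    have a2 := (hp θ).ne'
    have a3 := (Real.sqrt_pos.2 (hp2 θ)).ne'
    field_simp
  · intro θ hθ
    rw [min_eq_left (by positivity), max_eq_right (by positivity)] at hθ
    have hc : 0 < cos θ := cos_pos_of_mem_Ioo ⟨by linarith [hθ.1, pi_pos], hθ.2⟩
    have hl : 0 < 1 - w θ ^ 2 := by
      rw [hw]; have := hp2 θ; have := hden θ; positivity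
    have hwd : HasDerivAt w (((1 + k) * cos θ * (1 + k * sin θ ^ 2) - (1 + k) * sin θ * (k * (2 * sin θ ^ 1 * cos θ))) / (1 + k * sin θ ^ 2) ^ 2) θ := by
      have h2 : HasDerivAt (fun θ => 1 + k * sin θ ^ 2) (k * (2 * sin θ ^ 1 * cos θ)) θ := by
        simpa using (((hasDerivAt_sin θ).pow 2).const_mul k).const_add 1
      exact ((hasDerivAt_sin θ).const_mul (1 + k)).div h2 (hden θ).ne'
    have h3 := (Real.hasDerivAt_arcsin (x := w θ) (by nlinarith) (by nlinarith)).comp θ hwd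
    refine (h3.congr_deriv ?_).hasDerivWithinAt
    rw [hw, Real.sqrt_div (by have := hp2 θ; positivity), Real.sqrt_mul (by positivity), Real.sqrt_sq hc.le, Real.sqrt_sq (hden θ).le]
    have a1 := (hden θ).ne'
    have a3 := (Real.sqrt_pos.2 (hp2 θ)).ne'
    field_simp
    ring
  · refine ContinuousOn.div (by fun_prop) (by fun_prop) fun θ _ => ?_
    exact (mul_pos (hden θ) (Real.sqrt_pos.2 (hp2 θ))).ne'
  · refine ContinuousOn.div (by fun_prop) (by fun_prop) fun θ _ => ?_
    refine (Real.sqrt_pos.2 ?_).ne'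
    have hx : 0 < (1 - k) / (1 + k) := div_pos (by linarith) (by linarith)
    have : cos θ = 0 → 0 < sin θ ^ 2 := fun h => by
      have := sin_sq_add_cos_sq θ
      rw [h] at this; linarith
    by_cases h : cos θ = 0
    · have := this h; positivity
    · positivity

lemma K_nonneg (k : ℝ) : 0 ≤ ellipticK k := by
  unfold ellipticK
  apply intervalIntegral.integral_nonneg (by positivity)
  intros; positivity

lemma K_le (k : ℝ) (h0 : 0 ≤ k) (h1 : k < 1) : ellipticK k ≤ π / 2 * (1 - k) ^ (-(1/2) : ℝ) := by
  have : (1 - k) ^ (-(1/2) : ℝ) = 1 / √(1 - k) := by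
    rw [Real.rpow_neg (by linarith), Real.sqrt_eq_rpow]; simp
  rw [this]
  have := intervalIntegral.norm_integral_le_of_norm_le_const (a := 0) (b := π / 2) (C := 1 / √(1 - k))
    (f := fun θ => 1 / √(1 - k ^ 2 * sin θ ^ 2)) ?_
  · rw [sub_zero, abs_of_pos (by positivity)] at this
    rw [mul_comm]
    exact (le_abs_self _).trans this
  · intro θ _
    rw [Real.norm_of_nonneg (by positivity)]
    have : 0 < 1 - k := by linarith
    gcongr
    nlinarith [sin_sq_le_one θ, mul_nonneg h0 (sub_nonneg.2 h1.le), mul_nonneg (mul_nonneg h0 h0) (sub_nonneg.2 (sin_sq_le_one θ))]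

lemma K_meas : StronglyMeasurable ellipticK := by
  unfold ellipticK
  simp_rw [intervalIntegral.integral_of_le (show (0:ℝ) ≤ π / 2 by positivity)]
  refine MeasureTheory.StronglyMeasurable.integral_prod_right (f := fun k θ => 1 / √(1 - k ^ 2 * sin θ ^ 2)) ?_
  apply Measurable.stronglyMeasurable
  simp only [Function.uncurry_def]
  fun_prop

lemma int_rpow : IntegrableOn (fun k : ℝ => (1 - k) ^ (-(1/2) : ℝ)) (Set.Ioo 0 1) := by
  have := (intervalIntegral.intervalIntegrable_rpow' (a := 0) (b := 1) (r := -(1/2)) (by norm_num)).comp_sub_left 1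
  simp only [sub_zero, sub_self] at this
  have := this.symm
  rwa [intervalIntegrable_iff_integrableOn_Ioo_of_le (by norm_num)] at this

lemma K_int : IntegrableOn ellipticK (Set.Ioo 0 1) := by
  refine Integrable.mono' (int_rpow.const_mul (π / 2)) K_meas.aestronglyMeasurable ?_
  refine (ae_restrict_iff' measurableSet_Ioo).2 (ae_of_all _ fun k hk => ?_)
  rw [Real.norm_of_nonneg (K_nonneg k)]
  exact K_le k hk.1.le hk.2

lemma G_meas : StronglyMeasurable ellG := by
  unfold ellG
  simp_rw [intervalIntegral.integral_of_le (show (0:ℝ) ≤ π / 2 by positivity)]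
  refine MeasureTheory.StronglyMeasurable.integral_prod_right (f := fun x θ => 1 / √(cos θ ^ 2 + x ^ 2 * sin θ ^ 2)) ?_
  apply Measurable.stronglyMeasurable
  simp only [Function.uncurry_def]
  fun_prop

lemma G_eq (x : ℝ) (h0 : 0 < x) (h1 : x ≤ 1) : ellG x = 2 / (1 + x) * ellipticK ((1 - x) / (1 + x)) := by
  have := landen ((1 - x) / (1 + x)) (div_nonneg (by linarith) (by linarith)) (by rw [div_lt_one (by linarith)]; linarith)
  have e1 : (1 - (1 - x) / (1 + x)) / (1 + (1 - x) / (1 + x)) = x := by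
    field_simp; ring
  have e2 : 1 + (1 - x) / (1 + x) = 2 / (1 + x) := by
    field_simp; ring
  rwa [e1, e2] at this

lemma G_nonneg (x : ℝ) : 0 ≤ ellG x := by
  unfold ellG
  apply intervalIntegral.integral_nonneg (by positivity)
  intros; positivity

lemma G_le (x : ℝ) (h0 : 0 < x) (h1 : x ≤ 1) : ellG x ≤ π * x ^ (-(1/2) : ℝ) := by
  rw [G_eq x h0 h1]
  have h := K_le ((1 - x) / (1 + x)) (div_nonneg (by linarith) (by linarith)) (by rw [div_lt_one (by linarith)]; linarith)
  have e1 : (1 - (1 - x) / (1 + x)) = x * (2 / (1 + x)) := by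
    field_simp; ring
  rw [e1] at h
  have h2 : (x * (2 / (1 + x))) ^ (-(1/2) : ℝ) ≤ x ^ (-(1/2) : ℝ) := by
    apply Real.rpow_le_rpow_of_nonpos h0 _ (by norm_num)
    have : 1 ≤ 2 / (1 + x) := by rw [le_div_iff₀ (by linarith)]; linarith
    nlinarith
  have h3 : 2 / (1 + x) ≤ 2 := by rw [div_le_iff₀ (by linarith)]; linarith
  have h4 : 0 ≤ x ^ (-(1/2) : ℝ) := by positivity
  calc _ ≤ 2 * (π / 2 * x ^ (-(1/2) : ℝ)) := by
        apply mul_le_mul h3 _ (K_nonneg _) (by norm_num)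
        exact h.trans (by gcongr)
    _ = _ := by ring

lemma G_int : IntegrableOn ellG (Set.Ioo 0 1) := by
  have := (intervalIntegral.intervalIntegrable_rpow' (a := 0) (b := 1) (r := -(1/2)) (by norm_num))
  rw [intervalIntegrable_iff_integrableOn_Ioo_of_le (by norm_num)] at this
  refine Integrable.mono' (this.const_mul π) G_meas.aestronglyMeasurable ?_
  refine (ae_restrict_iff' measurableSet_Ioo).2 (ae_of_all _ fun k hk => ?_)
  rw [Real.norm_of_nonneg (G_nonneg k)]
  exact G_le k hk.1 hk.2.le

lemma ii_Ioo (a b : ℝ) (h : a ≤ b) (f : ℝ → ℝ) : ∫ x in a..b, f x = ∫ x in Set.Ioo a b, f x := by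
  rw [intervalIntegral.integral_of_le h, integral_Ioc_eq_integral_Ioo]

lemma cs_pos (θ a b : ℝ) (ha : 0 < a) (hb : 0 < b) : 0 < a * cos θ ^ 2 + b * sin θ ^ 2 := by
  rcases le_total a b with h | h
  · nlinarith [sin_sq_add_cos_sq θ, sq_nonneg (sin θ), sq_nonneg (cos θ), mul_nonneg (sub_nonneg.2 h) (sq_nonneg (sin θ))]
  · nlinarith [sin_sq_add_cos_sq θ, sq_nonneg (sin θ), sq_nonneg (cos θ), mul_nonneg (sub_nonneg.2 h) (sq_nonneg (cos θ))]

lemma sub_xu (q θ : ℝ) (hq0 : 0 ≤ q) (hq : q < 1) (hc : 0 < cos θ) :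
    ∫ x in Set.Ioo (0:ℝ) 1, 1 / (1 - q ^ 2 * x ^ 2) * (1 / √(cos θ ^ 2 + x ^ 2 * sin θ ^ 2)) =
    ∫ u in Set.Ioo (0:ℝ) 1, 1 / ((1 - q ^ 2 * u ^ 2) * cos θ ^ 2 + (1 - u ^ 2) * sin θ ^ 2) := by
  have hsc := sin_sq_add_cos_sq θ
  rw [← ii_Ioo _ _ zero_le_one, ← ii_Ioo _ _ zero_le_one]
  have hA : ∀ x : ℝ, 0 < cos θ ^ 2 + x ^ 2 * sin θ ^ 2 := fun x => by positivity
  have hAs : ∀ x : ℝ, 0 < √(cos θ ^ 2 + x ^ 2 * sin θ ^ 2) := fun x => Real.sqrt_pos.2 (hA x)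
  have hD : ∀ x : ℝ, HasDerivAt (fun x => x / √(cos θ ^ 2 + x ^ 2 * sin θ ^ 2))
      (cos θ ^ 2 / √(cos θ ^ 2 + x ^ 2 * sin θ ^ 2) ^ 3) x := by
    intro x
    have h1 : HasDerivAt (fun x => cos θ ^ 2 + x ^ 2 * sin θ ^ 2) (2 * x * sin θ ^ 2) x := by
      simpa using ((hasDerivAt_pow 2 x).mul_const (sin θ ^ 2)).const_add (cos θ ^ 2)
    refine ((hasDerivAt_id x).div (h1.sqrt (hA x).ne') (hAs x).ne').congr_deriv ?_
    have := (hAs x).ne'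
    have h2 := Real.sq_sqrt (hA x).le
    simp only [id]
    field_simp
    rw [h2]
    ring
  have hi : ∀ x : ℝ, 1 - (x / √(cos θ ^ 2 + x ^ 2 * sin θ ^ 2)) ^ 2 * (sin θ ^ 2 + q ^ 2 * cos θ ^ 2)
      = cos θ ^ 2 * (1 - q ^ 2 * x ^ 2) / (cos θ ^ 2 + x ^ 2 * sin θ ^ 2) := by
    intro x
    rw [div_pow, Real.sq_sqrt (hA x).le]
    have := (hA x).ne'
    field_simp
    ring
  have hrw : ∀ u : ℝ, (1 - q ^ 2 * u ^ 2) * cos θ ^ 2 + (1 - u ^ 2) * sin θ ^ 2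
      = 1 - u ^ 2 * (sin θ ^ 2 + q ^ 2 * cos θ ^ 2) := fun u => by linear_combination hsc
  have hqx : ∀ x ∈ Set.uIcc (0:ℝ) 1, 0 < 1 - q ^ 2 * x ^ 2 := by
    intro x hx
    rw [Set.uIcc_of_le zero_le_one] at hx
    have : q ^ 2 < 1 := by nlinarith
    have : x ^ 2 ≤ 1 := by nlinarith [hx.1, hx.2]
    nlinarith [sq_nonneg x, sq_nonneg q]
  have := intervalIntegral.integral_comp_mul_deriv'' (a := 0) (b := 1)
    (f := fun x => x / √(cos θ ^ 2 + x ^ 2 * sin θ ^ 2))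
    (f' := fun x => cos θ ^ 2 / √(cos θ ^ 2 + x ^ 2 * sin θ ^ 2) ^ 3)
    (g := fun u => 1 / (1 - u ^ 2 * (sin θ ^ 2 + q ^ 2 * cos θ ^ 2)))
    (fun x _ => (hD x).continuousAt.continuousWithinAt) (fun x _ => (hD x).hasDerivWithinAt) ?_ ?_
  · simp only [hrw]
    have e : cos θ ^ 2 + 1 ^ 2 * sin θ ^ 2 = 1 := by linarith
    simp only [e, Real.sqrt_one, zero_div, div_one] at this
    rw [← this]
    apply intervalIntegral.integral_congr
    intro x hx
    simp only [Function.comp]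
    rw [hi]
    have a1 := (hqx x hx).ne'
    have a2 := (hAs x).ne'
    have a3 := (hA x).ne'
    rw [show √(cos θ ^ 2 + x ^ 2 * sin θ ^ 2) ^ 3 = (cos θ ^ 2 + x ^ 2 * sin θ ^ 2) * √(cos θ ^ 2 + x ^ 2 * sin θ ^ 2) by
      rw [pow_succ, Real.sq_sqrt (hA x).le]]
    field_simp
  · refine ContinuousOn.div (by fun_prop) (by fun_prop) fun x _ => (pow_pos (hAs x) 3).ne'
  · refine ContinuousOn.div (by fun_prop) (by fun_prop) ?_
    rintro _ ⟨x, hx, rfl⟩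
    simp only
    rw [hi]
    exact (div_pos (mul_pos (by positivity) (hqx x hx)) (hA x)).ne'

lemma sub_sin (q : ℝ) :
    ∫ u in Set.Ioo (0:ℝ) 1, 1 / (√(1 - q ^ 2 * u ^ 2) * √(1 - u ^ 2)) = ellipticK q := by
  have him : sin '' Set.Ioo 0 (π / 2) = Set.Ioo 0 1 := by
    ext u; constructor
    · rintro ⟨θ, hθ, rfl⟩
      have h1 := sin_pos_of_pos_of_lt_pi hθ.1 (by linarith [hθ.2, pi_pos])
      have h2 : 0 < cos θ := cos_pos_of_mem_Ioo ⟨by linarith [hθ.1, pi_pos], hθ.2⟩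
      exact ⟨h1, by nlinarith [sin_sq_add_cos_sq θ]⟩
    · intro hu
      exact ⟨arcsin u, ⟨arcsin_pos.2 hu.1, arcsin_lt_pi_div_two.2 hu.2⟩, sin_arcsin (by linarith [hu.1]) hu.2.le⟩
  rw [← him, integral_image_eq_integral_abs_deriv_smul (f' := cos) measurableSet_Ioo
    (fun θ _ => (hasDerivAt_sin θ).hasDerivWithinAt)]
  · unfold ellipticK
    rw [ii_Ioo _ _ (by positivity)]
    apply setIntegral_congr_fun measurableSet_Ioo
    intro θ hθ
    have h2 : 0 < cos θ := cos_pos_of_mem_Ioo ⟨by linarith [hθ.1, pi_pos], hθ.2⟩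
    simp only [smul_eq_mul]
    rw [abs_of_pos h2, ← cos_sq', Real.sqrt_sq h2.le]
    field_simp
  · refine injOn_sin.mono ?_
    intro θ hθ
    exact ⟨by linarith [hθ.1, pi_pos], hθ.2.le⟩

lemma main_int (q : ℝ) (hq0 : 0 ≤ q) (hq : q < 1) :
    ∫ x in Set.Ioo (0:ℝ) 1, 1 / (1 - q ^ 2 * x ^ 2) * ellG x = π / 2 * ellipticK q := by
  have hpi : (0:ℝ) ≤ π / 2 := by positivity
  have hq2 : q ^ 2 < 1 := by nlinarith
  have hqx : ∀ x ∈ Set.Ioo (0:ℝ) 1, 1 - q ^ 2 ≤ 1 - q ^ 2 * x ^ 2 := by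
    intro x hx
    have : x ^ 2 ≤ 1 := by nlinarith [hx.1, hx.2]
    nlinarith [sq_nonneg q]
  have step1 : ∫ x in Set.Ioo (0:ℝ) 1, 1 / (1 - q ^ 2 * x ^ 2) * ellG x =
      ∫ x in Set.Ioo (0:ℝ) 1, ∫ θ in Set.Ioo 0 (π / 2), 1 / (1 - q ^ 2 * x ^ 2) * (1 / √(cos θ ^ 2 + x ^ 2 * sin θ ^ 2)) := by
    apply setIntegral_congr_fun measurableSet_Ioo
    intro x hx
    simp only
    rw [MeasureTheory.integral_const_mul, ellG, ii_Ioo _ _ hpi]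
  have int1 : Integrable (Function.uncurry fun (x θ : ℝ) => 1 / (1 - q ^ 2 * x ^ 2) * (1 / √(cos θ ^ 2 + x ^ 2 * sin θ ^ 2)))
      ((volume.restrict (Set.Ioo (0:ℝ) 1)).prod (volume.restrict (Set.Ioo (0:ℝ) (π / 2)))) := by
    rw [integrable_prod_iff]
    · simp only [Function.uncurry]
      constructor
      · refine (ae_restrict_iff' measurableSet_Ioo).2 (ae_of_all _ fun x hx => ?_)
        have : Continuous fun θ => 1 / (1 - q ^ 2 * x ^ 2) * (1 / √(cos θ ^ 2 + x ^ 2 * sin θ ^ 2)) := by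
          refine continuous_const.mul (continuous_const.div (by fun_prop) fun θ => ?_)
          have := cs_pos θ 1 (x ^ 2) one_pos (by have := hx.1; positivity)
          rw [one_mul] at this
          exact (Real.sqrt_pos.2 this).ne'
        exact (this.integrableOn_Icc (a := 0) (b := π / 2)).mono_set Set.Ioo_subset_Icc_self
      · refine Integrable.congr (f := fun x => 1 / (1 - q ^ 2 * x ^ 2) * ellG x) ?_ ?_
        · refine Integrable.mono' (G_int.const_mul (1 / (1 - q ^ 2))) ?_ ?_
          · exact (Measurable.aestronglyMeasurable (by fun_prop)).mul G_meas.aestronglyMeasurable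
          · refine (ae_restrict_iff' measurableSet_Ioo).2 (ae_of_all _ fun x hx => ?_)
            have h1 := hqx x hx
            have h2 : 0 < 1 - q ^ 2 := by linarith
            have h3 : 0 < 1 - q ^ 2 * x ^ 2 := by linarith
            have h4 := G_nonneg x
            rw [Real.norm_of_nonneg (by positivity)]
            gcongr
        · refine (ae_restrict_iff' measurableSet_Ioo).2 (ae_of_all _ fun x hx => ?_)
          have h3 : 0 < 1 - q ^ 2 * x ^ 2 := by linarith [hqx x hx]
          simp only
          rw [ellG, ii_Ioo _ _ hpi, ← MeasureTheory.integral_const_mul]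
          congr 1
          ext θ
          rw [Real.norm_of_nonneg (by positivity)]
    · apply Measurable.aestronglyMeasurable
      simp only [Function.uncurry_def]
      fun_prop
  have hu : ∀ u ∈ Set.Ioo (0:ℝ) 1, 0 < 1 - u ^ 2 ∧ 0 < 1 - q ^ 2 * u ^ 2 := by
    intro u h
    exact ⟨by nlinarith [h.1, h.2], by linarith [hqx u h]⟩
  have inner : ∀ u ∈ Set.Ioo (0:ℝ) 1, ∫ θ in Set.Ioo 0 (π / 2), 1 / ((1 - q ^ 2 * u ^ 2) * cos θ ^ 2 + (1 - u ^ 2) * sin θ ^ 2)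
      = π / 2 * (1 / (√(1 - q ^ 2 * u ^ 2) * √(1 - u ^ 2))) := by
    intro u h
    obtain ⟨h1, h2⟩ := hu u h
    have := integral_cs (√(1 - q ^ 2 * u ^ 2)) (√(1 - u ^ 2)) (Real.sqrt_pos.2 h2) (Real.sqrt_pos.2 h1)
    rw [Real.sq_sqrt h1.le, Real.sq_sqrt h2.le, ii_Ioo _ _ hpi] at this
    rw [this]; ring
  have int2 : Integrable (Function.uncurry fun (u θ : ℝ) => 1 / ((1 - q ^ 2 * u ^ 2) * cos θ ^ 2 + (1 - u ^ 2) * sin θ ^ 2))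
      ((volume.restrict (Set.Ioo (0:ℝ) 1)).prod (volume.restrict (Set.Ioo (0:ℝ) (π / 2)))) := by
    rw [integrable_prod_iff]
    · simp only [Function.uncurry]
      constructor
      · refine (ae_restrict_iff' measurableSet_Ioo).2 (ae_of_all _ fun u h => ?_)
        obtain ⟨h1, h2⟩ := hu u h
        have : Continuous fun θ => 1 / ((1 - q ^ 2 * u ^ 2) * cos θ ^ 2 + (1 - u ^ 2) * sin θ ^ 2) :=
          continuous_const.div (by fun_prop) fun θ => (cs_pos θ _ _ h2 h1).ne'
        exact (this.integrableOn_Icc (a := 0) (b := π / 2)).mono_set Set.Ioo_subset_Icc_self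
      · refine Integrable.congr (f := fun u => π / 2 * (1 / (√(1 - q ^ 2 * u ^ 2) * √(1 - u ^ 2)))) ?_ ?_
        · apply Integrable.const_mul
          refine Integrable.mono' (int_rpow.const_mul (1 / √(1 - q ^ 2))) ?_ ?_
          · exact (Measurable.aestronglyMeasurable (by fun_prop))
          · refine (ae_restrict_iff' measurableSet_Ioo).2 (ae_of_all _ fun u h => ?_)
            obtain ⟨h1, h2⟩ := hu u h
            have h3 : 0 < 1 - q ^ 2 := by linarith
            have h4 : 0 < 1 - u := by linarith [h.2]
            have : (1 - u) ^ (-(1/2) : ℝ) = 1 / √(1 - u) := by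
              rw [Real.rpow_neg (by linarith), Real.sqrt_eq_rpow]; simp
            rw [this, Real.norm_of_nonneg (by positivity), ← one_div_mul_one_div]
            have h5 := hqx u h
            have h6 : 1 - u ≤ 1 - u ^ 2 := by nlinarith [h.1, h.2]
            gcongr
        · refine (ae_restrict_iff' measurableSet_Ioo).2 (ae_of_all _ fun u h => ?_)
          obtain ⟨h1, h2⟩ := hu u h
          simp only
          rw [← inner u h]
          congr 1
          ext θ
          rw [Real.norm_of_nonneg (by positivity)]
    · apply Measurable.aestronglyMeasurable
      simp only [Function.uncurry_def]
      fun_prop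
  rw [step1, integral_integral_swap int1]
  have step2 : ∫ θ in Set.Ioo 0 (π / 2), ∫ x in Set.Ioo (0:ℝ) 1, 1 / (1 - q ^ 2 * x ^ 2) * (1 / √(cos θ ^ 2 + x ^ 2 * sin θ ^ 2))
     = ∫ θ in Set.Ioo 0 (π / 2), ∫ u in Set.Ioo (0:ℝ) 1, 1 / ((1 - q ^ 2 * u ^ 2) * cos θ ^ 2 + (1 - u ^ 2) * sin θ ^ 2) := by
    apply setIntegral_congr_fun measurableSet_Ioo
    intro θ hθ
    exact sub_xu q θ hq0 hq (cos_pos_of_mem_Ioo ⟨by linarith [hθ.1, pi_pos], hθ.2⟩)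
  rw [step2, ← integral_integral_swap int2, setIntegral_congr_fun measurableSet_Ioo inner,
    MeasureTheory.integral_const_mul, sub_sin]

lemma F_eq (t : ℝ) (h0 : 0 < t) (h1 : t ≤ 1) : ellipticF t = π / 2 * ellG t := by
  have him : (fun x : ℝ => (1 - x) / (1 + x)) '' Set.Ioo 0 1 = Set.Ioo 0 1 := by
    have hm : ∀ x ∈ Set.Ioo (0:ℝ) 1, (1 - x) / (1 + x) ∈ Set.Ioo (0:ℝ) 1 := by
      intro x hx
      have := hx.1
      have := hx.2
      exact ⟨div_pos (by linarith) (by linarith), by rw [div_lt_one (by linarith)]; linarith⟩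
    ext u; constructor
    · rintro ⟨x, hx, rfl⟩; exact hm x hx
    · intro hu
      refine ⟨_, hm u hu, ?_⟩
      have := hu.1
      simp only
      field_simp
      ring
  unfold ellipticF
  rw [ii_Ioo _ _ zero_le_one, ← him, integral_image_eq_integral_abs_deriv_smul (f' := fun x => - (2 / (1 + x) ^ 2)) measurableSet_Ioo]
  · rw [G_eq t h0 h1]
    have := main_int ((1 - t) / (1 + t)) (div_nonneg (by linarith) (by linarith)) (by rw [div_lt_one (by linarith)]; linarith)
    rw [mul_left_comm, ← this, ← MeasureTheory.integral_const_mul]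
    apply setIntegral_congr_fun measurableSet_Ioo
    intro x hx
    have hx0 := hx.1
    have hx1 := hx.2
    simp only [smul_eq_mul]
    rw [G_eq x hx.1 hx.2.le, abs_neg, abs_of_pos (by positivity)]
    have p1 : 0 < (1 - x) + t * (1 + x) := by nlinarith
    have p2 : 0 < (1 + x) + t * (1 - x) := by nlinarith
    have e1 : (1 - x) / (1 + x) + t = ((1 - x) + t * (1 + x)) / (1 + x) := by field_simp
    have e2 : 1 + t * ((1 - x) / (1 + x)) = ((1 + x) + t * (1 - x)) / (1 + x) := by field_simp
    have e3 : 1 - ((1 - t) / (1 + t)) ^ 2 * x ^ 2 = ((1 - x) + t * (1 + x)) * ((1 + x) + t * (1 - x)) / (1 + t) ^ 2 := by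
      field_simp; ring
    rw [e1, e2, e3, ← mul_assoc, ← mul_assoc, ← mul_assoc]
    congr 1
    field_simp
    ring
  · intro x hx
    have hx0 := hx.1
    refine ((((hasDerivAt_id x).const_sub 1).div ((hasDerivAt_id x).const_add 1) (by simp; linarith)).congr_deriv ?_).hasDerivWithinAt
    simp only [id]
    field_simp
    ring
  · intro x hx y hy h
    have hx0 := hx.1
    have hy0 := hy.1
    simp only at h
    rw [div_eq_div_iff (by linarith) (by linarith)] at h
    linarith

lemma F_inv (t : ℝ) (h0 : 0 < t) : ellipticF t = t⁻¹ * ellipticF t⁻¹ := by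
  unfold ellipticF
  rw [ii_Ioo _ _ zero_le_one, ii_Ioo _ _ zero_le_one, ← MeasureTheory.integral_const_mul]
  apply setIntegral_congr_fun measurableSet_Ioo
  intro k hk
  have := hk.1
  simp only
  rw [← mul_assoc]
  congr 1
  field_simp
  ring

lemma F_int (t : ℝ) (ht : 0 < t) : MeasureTheory.IntegrableOn
        (fun k : ℝ => (1 / (k + t) + 1 / (1 + t * k)) * ellipticK k) (Set.Ioo 0 1) := by
  refine Integrable.mono' (K_int.const_mul (1 / t + 1)) ?_ ?_
  · exact (Measurable.aestronglyMeasurable (by fun_prop)).mul K_meas.aestronglyMeasurable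
  · refine (ae_restrict_iff' measurableSet_Ioo).2 (ae_of_all _ fun k hk => ?_)
    have h4 := K_nonneg k
    have h5 := hk.1
    rw [Real.norm_of_nonneg (by positivity)]
    gcongr
    · linarith
    · rw [div_le_one (by positivity)]; nlinarith

lemma F_an : AnalyticOnNhd ℝ ellipticF (Set.Ioi 0) := by
  let S : ℂ → ℝ → ℂ := fun z k => (1 / ((k:ℂ) + z) + 1 / (1 + z * k)) * (ellipticK k : ℂ)
  have hre : ∀ t : ℝ, 0 < t → ellipticF t = (∫ k in Set.Ioo (0:ℝ) 1, S t k).re := by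
    intro t ht
    have : ∀ k : ℝ, S t k = (((1 / (k + t) + 1 / (1 + t * k)) * ellipticK k : ℝ) : ℂ) := by
      intro k; simp [S]
    simp only [this]
    rw [integral_complex_ofReal, Complex.ofReal_re, ellipticF, ii_Ioo _ _ zero_le_one]
  have hmeas : ∀ z, AEStronglyMeasurable (S z) (volume.restrict (Set.Ioo (0:ℝ) 1)) := by
    intro z
    have h1 : Measurable ellipticK := K_meas.measurable
    exact (Measurable.aestronglyMeasurable (by fun_prop))
  have n1 : ∀ (z : ℂ) (k : ℝ), 0 < z.re → 0 < k → z.re ≤ ‖(k:ℂ) + z‖ := by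
    intro z k hz hk
    refine le_trans ?_ (Complex.re_le_norm _)
    simp; linarith
  have n2 : ∀ (z : ℂ) (k : ℝ), 0 < z.re → 0 < k → 1 ≤ ‖1 + z * (k:ℂ)‖ := by
    intro z k hz hk
    refine le_trans ?_ (Complex.re_le_norm _)
    simp; positivity
  have hdiff : DifferentiableOn ℂ (fun z => ∫ k in Set.Ioo (0:ℝ) 1, S z k) {z | 0 < z.re} := by
    intro z0 hz0
    have hz0 : 0 < z0.re := hz0
    let r := z0.re / 2
    have hr : 0 < r := by simp only [r]; positivity
    have hball : ∀ z ∈ Metric.ball z0 r, r ≤ z.re := by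
      intro z hz
      rw [Metric.mem_ball, dist_eq_norm] at hz
      have := (Complex.abs_re_le_norm (z - z0)).trans hz.le
      rw [abs_le, Complex.sub_re] at this
      simp only [r] at *
      linarith [this.1]
    have := hasDerivAt_integral_of_dominated_loc_of_deriv_le (μ := volume.restrict (Set.Ioo (0:ℝ) 1))
      (F := S) (F' := fun z k => (-1 / ((k:ℂ) + z) ^ 2 + -k / (1 + z * k) ^ 2) * (ellipticK k : ℂ))
      (x₀ := z0) (s := Metric.ball z0 r) (bound := fun k => (1 / r ^ 2 + 1) * ellipticK k)
      (Metric.ball_mem_nhds z0 hr) (Filter.Eventually.of_forall hmeas) ?_ ?_ ?_ ?_ ?_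
    · exact this.2.differentiableAt.differentiableWithinAt
    · refine Integrable.mono' (K_int.const_mul (1 / z0.re + 1)) (hmeas z0) ?_
      refine (ae_restrict_iff' measurableSet_Ioo).2 (ae_of_all _ fun k hk => ?_)
      have h4 := K_nonneg k
      have a1 := n1 z0 k hz0 hk.1
      have a2 := n2 z0 k hz0 hk.1
      simp only [S]
      rw [norm_mul, Complex.norm_real, Real.norm_of_nonneg h4]
      gcongr
      refine (norm_add_le _ _).trans ?_
      rw [norm_div, norm_div, norm_one]
      gcongr
      rw [div_le_one (by linarith)]; exact a2
    · have h1 : Measurable ellipticK := K_meas.measurable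
      exact (Measurable.aestronglyMeasurable (by fun_prop))
    · refine (ae_restrict_iff' measurableSet_Ioo).2 (ae_of_all _ fun k hk z hz => ?_)
      have hz' := hball z hz
      have h4 := K_nonneg k
      have a1 := n1 z k (by linarith) hk.1
      have a2 := n2 z k (by linarith) hk.1
      rw [norm_mul, Complex.norm_real, Real.norm_of_nonneg h4]
      gcongr
      refine (norm_add_le _ _).trans ?_
      rw [norm_div, norm_div, norm_neg, norm_neg, norm_one, norm_pow, norm_pow, Complex.norm_real, Real.norm_of_nonneg hk.1.le]
      gcongr
      · exact hz'.trans a1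
      · rw [div_le_one (by positivity)]; nlinarith [hk.2]
    · exact K_int.const_mul _
    · refine (ae_restrict_iff' measurableSet_Ioo).2 (ae_of_all _ fun k hk z hz => ?_)
      have hz' := hball z hz
      have a1 := n1 z k (by linarith) hk.1
      have a2 := n2 z k (by linarith) hk.1
      have b1 : (k:ℂ) + z ≠ 0 := norm_pos_iff.1 (by linarith)
      have b2 : 1 + z * (k:ℂ) ≠ 0 := norm_pos_iff.1 (by linarith)
      have d1 : HasDerivAt (fun z : ℂ => 1 / ((k:ℂ) + z)) (-1 / ((k:ℂ) + z) ^ 2) z := by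
        simpa using ((hasDerivAt_id z).const_add (k:ℂ)).fun_inv b1
      have d2 : HasDerivAt (fun z : ℂ => 1 / (1 + z * (k:ℂ))) (-k / (1 + z * k) ^ 2) z := by
        simpa using (((hasDerivAt_id z).mul_const (k:ℂ)).const_add 1).fun_inv b2
      exact (d1.add d2).mul_const _
  have hopen : IsOpen {z : ℂ | 0 < z.re} := isOpen_lt continuous_const Complex.continuous_re
  intro t ht
  have ht : 0 < t := ht
  have h := hdiff.analyticAt (z := (t:ℂ)) (hopen.mem_nhds (by simpa using ht))
  refine h.re_ofReal.congr ?_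
  filter_upwards [Ioi_mem_nhds ht] with s hs
  exact (hre s hs).symm


/-- **Lemma 7.2 / Appendix B.** The function
`f(t) = ∫₀¹ (1/(k+t) + 1/(1+tk)) K(k) dk` (whose integrand is Lebesgue-integrable on
`(0,1)` for every `t > 0`) is real-analytic on `(0, ∞)` and has the closed form
`f(t) = (π/2) K(√(1−t²))` for `0 < t ≤ 1` and `f(t) = (π/(2t)) K(√(1−t⁻²))` for `t > 1`. -/
theorem cp1_lumps_elliptic_integral_identity :
    (∀ t : ℝ, 0 < t → MeasureTheory.IntegrableOn
        (fun k : ℝ => (1 / (k + t) + 1 / (1 + t * k)) * ellipticK k) (Set.Ioo 0 1)) ∧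
    AnalyticOnNhd ℝ ellipticF (Set.Ioi 0) ∧
    (∀ t : ℝ, 0 < t → t ≤ 1 →
        ellipticF t = (Real.pi / 2) * ellipticK (Real.sqrt (1 - t ^ 2))) ∧
    (∀ t : ℝ, 1 < t →
        ellipticF t = (Real.pi / (2 * t)) * ellipticK (Real.sqrt (1 - (t⁻¹) ^ 2))) := by
  refine ⟨F_int, F_an, fun t h0 h1 => ?_, fun t h1 => ?_⟩
  · rw [F_eq t h0 h1, ellK_eq_G t h0.le h1]
  · have h0 : 0 < t := by linarith
    have h2 : t⁻¹ ≤ 1 := inv_le_one_of_one_le₀ h1.le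
    rw [F_inv t h0, F_eq _ (inv_pos.2 h0) h2, ellK_eq_G _ (inv_pos.2 h0).le h2]
    field_simp
end

section
/- For (a,b,c,d) ∈ ℂ⁴ with ad − bc ≠ 0, let M_{(a,b,c,d)} denote the degree-one lump W(z) = (a e^z + b)/(c e^z + d) on the cylinder, with endpoints ℓ₊ = [a : c] and ℓ₋ = [b : d] in the complex projective line ℂP¹. Then: (i) ℓ₊ ≠ ℓ₋ for every such (a,b,c,d) (no one-lump has equal endpoints, so the range of ℓ = (ℓ₋, ℓ₊) misses the diagonal of ℂP¹ × ℂP¹); (ii) for every pair of distinct points p ≠ q in ℂP¹ there exists (a,b,c,d) with ad − bc ≠ 0, ℓ₊ = p and ℓ₋ = q; (iii) if (a₁,b₁,c₁,d₁) and (a₂,b₂,c₂,d₂), both with nonzero determinant, have the same endpoints ([a₁:c₁] = [a₂:c₂] and [b₁:d₁] = [b₂:d₂]), then there is a unique λ ∈ ℂˣ such that the matrices (a₂, b₂; c₂, d₂) and (a₁λ, b₁; c₁λ, d₁) are proportional, i.e. the two lumps differ exactly by the translation z ↦ z + log λ of the cylinder. -/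
/-- The first column `![a, c]` of an invertible `2×2` matrix is nonzero. -/
lemma moebius_col_fst_ne_zero {a b c d : ℂ} (h : a * d - b * c ≠ 0) :
    ![a, c] ≠ (0 : Fin 2 → ℂ) := by
  intro hz
  apply h
  have ha : a = 0 := by simpa using congrFun hz 0
  have hc : c = 0 := by simpa using congrFun hz 1
  simp [ha, hc]

/-- The second column `![b, d]` of an invertible `2×2` matrix is nonzero. -/
lemma moebius_col_snd_ne_zero {a b c d : ℂ} (h : a * d - b * c ≠ 0) :
    ![b, d] ≠ (0 : Fin 2 → ℂ) := by
  intro hz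
  apply h
  have hb : b = 0 := by simpa using congrFun hz 0
  have hd : d = 0 := by simpa using congrFun hz 1
  simp [hb, hd]

/-- **The endpoint map on one-lumps is a principal `ℂˣ`-bundle over
`ℂP¹ × ℂP¹ ∖ Δ`** (degree-one part of Proposition 3.2). For the one-lump
`W(z) = (a e^z + b)/(c e^z + d)`, `ad − bc ≠ 0`, with endpoints `ℓ₊ = [a : c]`,
`ℓ₋ = [b : d]` in `ℂP¹`:
(i) `ℓ₊ ≠ ℓ₋` always; (ii) every pair of distinct points of `ℂP¹` is attained as the pair
of endpoints; (iii) two one-lumps with the same endpoints differ by a unique translation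
`z ↦ z + log λ` of the cylinder, i.e. there is a unique `λ ∈ ℂˣ` making the corresponding
matrices proportional. -/
theorem cp1_one_lump_endpoint_bundle :
    (∀ (a b c d : ℂ) (h : a * d - b * c ≠ 0),
      Projectivization.mk ℂ ![a, c] (moebius_col_fst_ne_zero h)
        ≠ Projectivization.mk ℂ ![b, d] (moebius_col_snd_ne_zero h)) ∧
    (∀ p q : Projectivization ℂ (Fin 2 → ℂ), p ≠ q →
      ∃ (a b c d : ℂ) (h : a * d - b * c ≠ 0),
        Projectivization.mk ℂ ![a, c] (moebius_col_fst_ne_zero h) = p ∧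
        Projectivization.mk ℂ ![b, d] (moebius_col_snd_ne_zero h) = q) ∧
    (∀ (a₁ b₁ c₁ d₁ a₂ b₂ c₂ d₂ : ℂ)
      (h₁ : a₁ * d₁ - b₁ * c₁ ≠ 0) (h₂ : a₂ * d₂ - b₂ * c₂ ≠ 0),
      Projectivization.mk ℂ ![a₁, c₁] (moebius_col_fst_ne_zero h₁)
        = Projectivization.mk ℂ ![a₂, c₂] (moebius_col_fst_ne_zero h₂) →
      Projectivization.mk ℂ ![b₁, d₁] (moebius_col_snd_ne_zero h₁)
        = Projectivization.mk ℂ ![b₂, d₂] (moebius_col_snd_ne_zero h₂) →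
      ∃! l : ℂˣ, ∃ μ : ℂˣ,
        a₂ = (μ : ℂ) * (a₁ * (l : ℂ)) ∧ b₂ = (μ : ℂ) * b₁ ∧
        c₂ = (μ : ℂ) * (c₁ * (l : ℂ)) ∧ d₂ = (μ : ℂ) * d₁) := by
  refine ⟨?_, ?_, ?_⟩
  · intro a b c d h e
    rw [Projectivization.mk_eq_mk_iff'] at e
    obtain ⟨t, ht⟩ := e
    have h0 : t * b = a := by simpa using congrFun ht 0
    have h1 : t * d = c := by simpa using congrFun ht 1
    apply h
    rw [← h0, ← h1]
    ring
  · intro p q hpq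
    induction p using Projectivization.ind with
    | h v hv =>
    induction q using Projectivization.ind with
    | h w hw =>
    have hvv : ![v 0, v 1] = v := by
      ext i; fin_cases i <;> rfl
    have hww : ![w 0, w 1] = w := by
      ext i; fin_cases i <;> rfl
    refine ⟨v 0, w 0, v 1, w 1, ?_, ?_, ?_⟩
    · intro hd
      apply hpq
      rw [Projectivization.mk_eq_mk_iff']
      by_cases h0 : w 0 = 0
      · have h1 : w 1 ≠ 0 := by
          intro h1
          apply hw
          ext i; fin_cases i
          · exact h0
          · exact h1
        refine ⟨v 1 / w 1, ?_⟩
        ext i; fin_cases i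
        · simp only [Pi.smul_apply, smul_eq_mul, Fin.zero_eta]
          field_simp
          linear_combination -hd
        · simp only [Pi.smul_apply, smul_eq_mul, Fin.mk_one]
          field_simp
      · refine ⟨v 0 / w 0, ?_⟩
        ext i; fin_cases i
        · simp only [Pi.smul_apply, smul_eq_mul, Fin.zero_eta]
          field_simp
        · simp only [Pi.smul_apply, smul_eq_mul, Fin.mk_one]
          field_simp
          linear_combination hd
    · congr 1
    · congr 1
  · intro a₁ b₁ c₁ d₁ a₂ b₂ c₂ d₂ h₁ h₂ e f
    have e' := e.symm
    have f' := f.symm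
    rw [Projectivization.mk_eq_mk_iff] at e' f'
    obtain ⟨s, hs⟩ := e'
    obtain ⟨t, ht⟩ := f'
    have hs0 : (s : ℂ) * a₁ = a₂ := by simpa [Units.smul_def] using congrFun hs 0
    have hs1 : (s : ℂ) * c₁ = c₂ := by simpa [Units.smul_def] using congrFun hs 1
    have ht0 : (t : ℂ) * b₁ = b₂ := by simpa [Units.smul_def] using congrFun ht 0
    have ht1 : (t : ℂ) * d₁ = d₂ := by simpa [Units.smul_def] using congrFun ht 1
    have htt : (t : ℂ) * (t⁻¹ : ℂˣ) = 1 := t.mul_inv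
    refine ⟨s * t⁻¹, ⟨t, ?_, ht0.symm, ?_, ht1.symm⟩, ?_⟩
    · rw [← hs0, Units.val_mul]
      linear_combination (-(s : ℂ) * a₁) * htt
    · rw [← hs1, Units.val_mul]
      linear_combination (-(s : ℂ) * c₁) * htt
    · rintro l ⟨m, ha, hb, hc, hd⟩
      have hm : (m : ℂ) = t := by
        apply mul_right_cancel₀ h₁
        linear_combination a₁ * (-ht1 - hd) - c₁ * (-ht0 - hb)
      have hl : (m : ℂ) * l = s := by
        apply mul_right_cancel₀ h₁
        linear_combination d₁ * (-hs0 - ha) - b₁ * (-hs1 - hc)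
      have hm' : m = t := Units.ext hm
      have hl' : m * l = s := Units.ext (by simpa using hl)
      rw [← hl', hm']
      simp
end
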